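/- Let F be a number field containing the n-th roots of unity, n ≥ 2, N a positive multiple of n, and P(T) ∈ O_F[T] a separable polynomial of degree N whose Galois group over F contains an element fixing no root. Set E = F(T)(P(T)^{1/n}). Then E/F(T) is an F-regular Galois extension with group Z/nZ, and for every nontrivial subgroup H ≤ Z/nZ there exists a Galois extension of F with group H that is not a specialization of E/F(T); in particular E/F(T) is not Z/nZ-parametric. -/

import Mathlib

open Polynomial NumberField IntermediateField

set_option linter.unusedSectionVars false

section EulerBounds
open UniqueFactorizationMonoid IsDedekindDomain

variable {R : Type*} [CommRing R] [IsDedekindDomain R]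

lemma euler_lower (w : Ideal R →* ℝ) (hw0 : ∀ I, 0 ≤ w I) (hs : Summable w)
    (T : Finset (HeightOneSpectrum R)) :
    ∏ v ∈ T, (1 + w v.asIdeal) ≤ ∑' I, w I := by
  classical
  rw [Finset.prod_one_add]
  have hinj : Set.InjOn (fun S : Finset (HeightOneSpectrum R) => ∏ v ∈ S, v.asIdeal)
      (T.powerset : Set (Finset (HeightOneSpectrum R))) := by
    intro S _ S' _ h
    have key : ∀ S : Finset (HeightOneSpectrum R),
        normalizedFactors (∏ v ∈ S, v.asIdeal) = S.val.map (fun v => v.asIdeal) := by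
      intro S
      apply normalizedFactors_prod_of_prime
      intro p hp
      obtain ⟨v, _, rfl⟩ := Multiset.mem_map.1 hp
      exact v.prime
    have h2 := congrArg normalizedFactors h
    simp only [key] at h2
    have := Multiset.map_injective (fun (v v' : HeightOneSpectrum R) h => HeightOneSpectrum.ext h) h2
    exact Finset.val_injective this
  calc ∑ t ∈ T.powerset, ∏ i ∈ t, w i.asIdeal
      = ∑ t ∈ T.powerset, w (∏ i ∈ t, i.asIdeal) := by simp [map_prod]
    _ = ∑ I ∈ T.powerset.image (fun S => ∏ v ∈ S, v.asIdeal), w I := by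
        rw [Finset.sum_image hinj]
    _ ≤ ∑' I, w I := hs.sum_le_tsum _ (fun I _ => hw0 I)

lemma euler_upper (w : Ideal R →* ℝ) (hw0 : ∀ I, 0 ≤ w I) (hbot : w ⊥ = 0)
    (hlt : ∀ v : HeightOneSpectrum R, w v.asIdeal < 1)
    (A : Finset (Ideal R)) :
    ∃ T : Finset (HeightOneSpectrum R), ∑ I ∈ A, w I ≤ ∏ v ∈ T, (1 - w v.asIdeal)⁻¹ := by
  classical
  set A' := A.filter (· ≠ ⊥) with hA'
  have hAA : ∑ I ∈ A, w I = ∑ I ∈ A', w I := by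
    rw [hA', Finset.sum_filter]
    refine Finset.sum_congr rfl fun I _ => ?_
    split_ifs with h
    · rfl
    · push Not at h; rw [h, hbot]
  have hne : ∀ I ∈ A', I ≠ ⊥ := fun I hI => (Finset.mem_filter.1 hI).2
  set T : Finset (HeightOneSpectrum R) := 
    (A'.biUnion (fun I => (normalizedFactors I).toFinset)).attach.image (fun q =>
      HeightOneSpectrum.ofPrime (p := q.1) (by
        obtain ⟨I, _, hI⟩ := Finset.mem_biUnion.1 q.2
        exact prime_of_normalized_factor _ (Multiset.mem_toFinset.1 hI))) with hT
  have hTmem : ∀ I ∈ A', ∀ q ∈ normalizedFactors I, ∃ v ∈ T, v.asIdeal = q := by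
    intro I hI q hq
    have h1 : q ∈ A'.biUnion (fun I => (normalizedFactors I).toFinset) :=
      Finset.mem_biUnion.2 ⟨I, hI, Multiset.mem_toFinset.2 hq⟩
    exact ⟨_, Finset.mem_image.2 ⟨⟨q, h1⟩, Finset.mem_attach _ _, rfl⟩, rfl⟩
  refine ⟨T, ?_⟩
  obtain ⟨K, hK⟩ : ∃ K : ℕ, ∀ I ∈ A', Multiset.card (normalizedFactors I) < K :=
    ⟨A'.sup (fun I => Multiset.card (normalizedFactors I)) + 1, fun I hI => 
      Nat.lt_succ_of_le (Finset.le_sup (f := fun I => Multiset.card (normalizedFactors I)) hI)⟩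
  have hgeo : ∀ v ∈ T, ∑ k ∈ Finset.range K, w v.asIdeal ^ k ≤ (1 - w v.asIdeal)⁻¹ := by
    intro v _
    have := (summable_geometric_of_lt_one (hw0 v.asIdeal) (hlt v)).sum_le_tsum (Finset.range K)
      (fun k _ => pow_nonneg (hw0 _) k)
    rwa [tsum_geometric_of_lt_one (hw0 _) (hlt v)] at this
  have hfac : ∀ I ∈ A', I = ∏ v ∈ T, v.asIdeal ^ (normalizedFactors I).count v.asIdeal := by
    intro I hI
    conv_lhs => rw [← Ideal.prod_normalizedFactors_eq_self (hne I hI)]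
    rw [Finset.prod_multiset_count_of_subset _ (T.image (fun v => v.asIdeal)) ?_]
    · rw [Finset.prod_image]
      intro v _ v' _ h
      exact HeightOneSpectrum.ext h
    · intro q hq
      obtain ⟨v, hv, hvq⟩ := hTmem I hI q (Multiset.mem_toFinset.1 hq)
      exact Finset.mem_image.2 ⟨v, hv, hvq⟩
  let g : Ideal R → (∀ v ∈ T, ℕ) := fun I v _ => (normalizedFactors I).count v.asIdeal
  have hg : Set.InjOn g (A' : Set (Ideal R)) := by
    intro I hI J hJ h
    rw [hfac I hI, hfac J hJ]
    refine Finset.prod_congr rfl fun v hv => ?_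
    have := congrFun (congrFun h v) hv
    simp only [g] at this
    rw [this]
  calc ∑ I ∈ A, w I = ∑ I ∈ A', w I := hAA
    _ = ∑ I ∈ A', ∏ x ∈ T.attach, w x.1.asIdeal ^ (g I x.1 x.2) := by
        refine Finset.sum_congr rfl fun I hI => ?_
        conv_lhs => rw [hfac I hI]
        rw [map_prod, ← Finset.prod_attach]
        simp [g]
    _ = ∑ f ∈ A'.image g, ∏ x ∈ T.attach, w x.1.asIdeal ^ (f x.1 x.2) := by
        rw [Finset.sum_image hg]
    _ ≤ ∑ f ∈ T.pi (fun _ => Finset.range K), ∏ x ∈ T.attach, w x.1.asIdeal ^ (f x.1 x.2) := by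
        apply Finset.sum_le_sum_of_subset_of_nonneg
        · intro f hf
          obtain ⟨I, hI, rfl⟩ := Finset.mem_image.1 hf
          refine Finset.mem_pi.2 fun v hv => Finset.mem_range.2 ?_
          exact lt_of_le_of_lt (Multiset.count_le_card _ _) (hK I hI)
        · intro f _ _
          exact Finset.prod_nonneg fun x _ => pow_nonneg (hw0 _) _
    _ = ∏ v ∈ T, ∑ k ∈ Finset.range K, w v.asIdeal ^ k := by
        rw [Finset.prod_sum]
    _ ≤ ∏ v ∈ T, (1 - w v.asIdeal)⁻¹ :=
        Finset.prod_le_prod (fun v _ => Finset.sum_nonneg fun k _ => pow_nonneg (hw0 _) k) hgeo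

lemma HeightOneSpectrum_asIdeal_injective :
    Function.Injective (fun v : HeightOneSpectrum R => v.asIdeal) :=
  fun _ _ h => HeightOneSpectrum.ext h

lemma euler_log (w : Ideal R →* ℝ) (hw0 : ∀ I, 0 ≤ w I) (hbot : w ⊥ = 0) (hs : Summable w)
    (hlt : ∀ v : HeightOneSpectrum R, w v.asIdeal ≤ 1 / 2) :
    |∑' v : HeightOneSpectrum R, w v.asIdeal - Real.log (∑' I, w I)| ≤
      2 * ∑' v : HeightOneSpectrum R, (w v.asIdeal) ^ 2 := by
  have hsv : Summable (fun v : HeightOneSpectrum R => w v.asIdeal) :=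
    hs.comp_injective HeightOneSpectrum_asIdeal_injective
  have hsv2 : Summable (fun v : HeightOneSpectrum R => w v.asIdeal ^ 2) := by
    refine Summable.of_nonneg_of_le (fun v => by positivity) (fun v => ?_) hsv
    nlinarith [hw0 v.asIdeal, hlt v]
  have hZ1 : 1 ≤ ∑' I, w I := by
    simpa using euler_lower w hw0 hs ∅
  have hZ : 0 < ∑' I, w I := by linarith
  have h2 : 0 ≤ ∑' v : HeightOneSpectrum R, (w v.asIdeal) ^ 2 := tsum_nonneg fun v => by positivity
  rw [abs_le]
  constructor
  · have : Real.log (∑' I, w I) ≤ ∑' v : HeightOneSpectrum R, w v.asIdeal +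
        2 * ∑' v : HeightOneSpectrum R, (w v.asIdeal) ^ 2 := by
      rw [Real.log_le_iff_le_exp hZ]
      refine hs.tsum_le_of_sum_le fun A => ?_
      obtain ⟨T, hT⟩ := euler_upper w hw0 hbot (fun v => by linarith [hlt v]) A
      refine hT.trans ?_
      have h3 : ∀ v ∈ T, (1 - w v.asIdeal)⁻¹ ≤ Real.exp (w v.asIdeal + 2 * w v.asIdeal ^ 2) := by
        intro v _
        set x := w v.asIdeal
        have hx0 : 0 ≤ x := hw0 _
        have hx1 : x ≤ 1 / 2 := hlt v
        refine le_trans ?_ (Real.add_one_le_exp _)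
        rw [inv_le_iff_one_le_mul₀ (by linarith)]
        nlinarith [mul_nonneg hx0 hx0, mul_nonneg (mul_nonneg hx0 hx0) (sub_nonneg.2 hx1)]
      refine (Finset.prod_le_prod (fun v _ => ?_) h3).trans ?_
      · exact inv_nonneg.2 (by linarith [hlt v])
      · rw [← Real.exp_sum, Real.exp_le_exp, Finset.sum_add_distrib, ← Finset.mul_sum]
        have := hsv.sum_le_tsum T (fun v _ => hw0 _)
        have := hsv2.sum_le_tsum T (fun v _ => by positivity)
        linarith
    linarith
  · have : ∑' v : HeightOneSpectrum R, w v.asIdeal ≤ Real.log (∑' I, w I) +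
        ∑' v : HeightOneSpectrum R, (w v.asIdeal) ^ 2 := by
      refine hsv.tsum_le_of_sum_le fun T => ?_
      have h1 := Real.log_le_log (Finset.prod_pos fun v _ => by linarith [hw0 v.asIdeal])
        (euler_lower w hw0 hs T)
      rw [Real.log_prod (fun v _ => by linarith [hw0 v.asIdeal])] at h1
      have h3 : ∀ v ∈ T, w v.asIdeal - w v.asIdeal ^ 2 ≤ Real.log (1 + w v.asIdeal) := by
        intro v _
        set x := w v.asIdeal
        have hx0 : 0 ≤ x := hw0 _
        refine le_trans ?_ (Real.one_sub_inv_le_log_of_pos (by linarith))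
        have : 1 - (1 + x)⁻¹ = x / (1 + x) := by field_simp; ring
        rw [this, le_div_iff₀ (by linarith)]
        nlinarith [mul_nonneg hx0 hx0, mul_nonneg (mul_nonneg hx0 hx0) hx0]
      have h4 := Finset.sum_le_sum h3
      rw [Finset.sum_sub_distrib] at h4
      have := hsv2.sum_le_tsum T (fun v _ => by positivity)
      linarith
    linarith
end EulerBounds
section ZetaBounds
open UniqueFactorizationMonoid IsDedekindDomain Filter Topology

variable (K : Type*) [Field K] [NumberField K]

/-- The multiplicative function `I ↦ N(I)^{-s}`. -/
noncomputable def normW (s : ℝ) : Ideal (𝓞 K) →* ℝ where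
  toFun I := (Ideal.absNorm I : ℝ) ^ (-s)
  map_one' := by simp
  map_mul' I J := by
    rw [map_mul, Nat.cast_mul, Real.mul_rpow (by positivity) (by positivity)]

lemma normW_apply (s : ℝ) (I : Ideal (𝓞 K)) : normW K s I = (Ideal.absNorm I : ℝ) ^ (-s) := rfl

lemma normW_nonneg (s : ℝ) (I : Ideal (𝓞 K)) : 0 ≤ normW K s I := by
  rw [normW_apply]; positivity

lemma normW_bot {s : ℝ} (hs : s ≠ 0) : normW K s ⊥ = 0 := by
  rw [normW_apply]; simp [Real.zero_rpow, hs]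

/-- Number of ideals of norm `m`. -/
noncomputable def numId (m : ℕ) : ℕ := Nat.card {I : Ideal (𝓞 K) // Ideal.absNorm I = m}

lemma normW_tsum_fiber (s : ℝ) (m : ℕ) :
    ∑' I : {I : Ideal (𝓞 K) // Ideal.absNorm I = m}, normW K s I.1 = numId K m * (m : ℝ) ^ (-s) := by
  have : ∀ I : {I : Ideal (𝓞 K) // Ideal.absNorm I = m}, normW K s I.1 = (m : ℝ) ^ (-s) := by
    intro I; rw [normW_apply, I.2]
  simp_rw [this]
  have : Finite {I : Ideal (𝓞 K) // Ideal.absNorm I = m} := (Ideal.finite_setOfPred_absNorm_eq m)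
  rw [tsum_const, numId, nsmul_eq_mul]

lemma term_eq {s : ℝ} (hs : 1 < s) (m : ℕ) :
    LSeries.term (fun n ↦ (Nat.card {I : Ideal (𝓞 K) // Ideal.absNorm I = n} : ℂ)) s m =
      ((numId K m * (m : ℝ) ^ (-s) : ℝ) : ℂ) := by
  rcases eq_or_ne m 0 with rfl | hm
  · have : -s ≠ 0 := by linarith
    simp [Real.zero_rpow this]
  · rw [LSeries.term_of_ne_zero hm, numId]
    push_cast
    rw [Complex.ofReal_cpow (by positivity), div_eq_mul_inv]
    push_cast
    rw [Complex.cpow_neg]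

lemma normW_summable {s : ℝ} (hs : 1 < s) (h : dedekindZeta K s ≠ 0) :
    Summable (normW K s) ∧ dedekindZeta K s = ((∑' I, normW K s I : ℝ) : ℂ) := by
  have h1 : LSeriesSummable (fun n ↦ (Nat.card {I : Ideal (𝓞 K) // Ideal.absNorm I = n} : ℂ)) s := by
    by_contra hc
    apply h
    exact tsum_eq_zero_of_not_summable hc
  unfold LSeriesSummable at h1
  have h2 : Summable (fun m : ℕ => numId K m * (m : ℝ) ^ (-s)) := by
    rw [← Complex.summable_ofReal]
    refine h1.congr fun m => ?_
    exact (term_eq K hs m)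
  have h3 : Summable (normW K s) := by
    rw [← (Equiv.sigmaFiberEquiv (fun I : Ideal (𝓞 K) => Ideal.absNorm I)).summable_iff]
    refine (summable_sigma_of_nonneg (fun _ => normW_nonneg K s _)).2 ⟨?_, ?_⟩
    · intro m
      have : Finite {I : Ideal (𝓞 K) // Ideal.absNorm I = m} := (Ideal.finite_setOfPred_absNorm_eq m)
      exact Summable.of_finite
    · refine h2.congr fun m => ?_
      exact (normW_tsum_fiber K s m).symm
  refine ⟨h3, ?_⟩
  unfold dedekindZeta LSeries
  rw [tsum_congr (fun m => term_eq K hs m), ← Complex.ofReal_tsum]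
  congr 1
  rw [← (Equiv.sigmaFiberEquiv (fun I : Ideal (𝓞 K) => Ideal.absNorm I)).tsum_eq]
  refine Eq.trans ?_ (Summable.tsum_sigma ((Equiv.sigmaFiberEquiv
    (fun I : Ideal (𝓞 K) => Ideal.absNorm I)).summable_iff.2 h3)).symm
  refine tsum_congr fun m => ?_
  exact (normW_tsum_fiber K s m).symm

lemma zeta_eventually : ∃ C : ℝ, ∀ᶠ s : ℝ in 𝓝[>] 1, 1 < s ∧ s < 2 ∧ Summable (normW K s) ∧
    |Real.log (∑' I, normW K s I) + Real.log (s - 1)| ≤ C := by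
  have h := tendsto_sub_one_mul_dedekindZeta_nhdsGT K
  have hr := dedekindZeta_residue_pos K
  set ρ := dedekindZeta_residue K
  have h1 : ∀ᶠ s : ℝ in 𝓝[>] 1, ((s : ℂ) - 1) * dedekindZeta K s ≠ 0 := 
    h.eventually_ne (by exact_mod_cast hr.ne')
  have hgt : ∀ᶠ s : ℝ in 𝓝[>] 1, 1 < s := eventually_mem_nhdsWithin
  have hlt : ∀ᶠ s : ℝ in 𝓝[>] 1, s < 2 := 
    nhdsWithin_le_nhds (Iio_mem_nhds (by norm_num))
  have h2 : Tendsto (fun s : ℝ => (s - 1) * ∑' I, normW K s I) (𝓝[>] 1) (𝓝 ρ) := by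
    have := (Complex.continuous_re.tendsto _).comp h
    refine (this.congr' ?_)
    filter_upwards [h1, hgt] with s hs hs1
    rw [Function.comp_apply, (normW_summable K hs1 (right_ne_zero_of_mul hs)).2]
    norm_cast
  have h3 : Tendsto (fun s : ℝ => Real.log ((s - 1) * ∑' I, normW K s I)) (𝓝[>] 1)
      (𝓝 (Real.log ρ)) := h2.log hr.ne'
  have h4 := h3.abs.eventually_lt_const (lt_add_one _)
  refine ⟨|Real.log ρ| + 1, ?_⟩
  filter_upwards [h1, hgt, hlt, h4] with s hs hs1 hs2 h4
  have hh := normW_summable K hs1 (right_ne_zero_of_mul hs)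
  refine ⟨hs1, hs2, hh.1, ?_⟩
  have hne : ∑' I, normW K s I ≠ 0 := by
    intro h0
    rw [h0] at hh
    exact (right_ne_zero_of_mul hs) (by simpa using hh.2)
  rw [Real.log_mul (by linarith) hne] at h4
  rw [add_comm]
  exact h4.le

lemma two_le_absNorm (v : HeightOneSpectrum (𝓞 K)) : 2 ≤ Ideal.absNorm v.asIdeal := by
  have h0 : Ideal.absNorm v.asIdeal ≠ 0 := by
    rw [Ne, Ideal.absNorm_eq_zero_iff]; exact v.ne_bot
  have h1 : Ideal.absNorm v.asIdeal ≠ 1 := by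
    rw [Ne, Ideal.absNorm_eq_one_iff]; exact v.isPrime.ne_top
  omega

/-- The rational prime below `v`. -/
noncomputable def ratPrime (v : HeightOneSpectrum (𝓞 K)) : Nat.Primes :=
  ⟨Ideal.absNorm (v.asIdeal.under ℤ), by
    have := v.isPrime
    have : NeZero v.asIdeal := ⟨v.ne_bot⟩
    exact Nat.absNorm_under_prime v.asIdeal⟩

lemma absNorm_eq_ratPrime_pow (v : HeightOneSpectrum (𝓞 K)) :
    ∃ f : ℕ, 1 ≤ f ∧ Ideal.absNorm v.asIdeal = (ratPrime K v : ℕ) ^ f := by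
  have := v.isPrime
  refine ⟨v.asIdeal.inertiaDeg ℤ, ?_, ?_⟩
  · exact Ideal.inertiaDeg_pos v.asIdeal ℤ
  · exact (Ideal.absNorm_pow_inertiaDeg (v.asIdeal.under ℤ) v.asIdeal).symm

lemma ratPrime_mem (v : HeightOneSpectrum (𝓞 K)) : ((ratPrime K v : ℕ) : 𝓞 K) ∈ v.asIdeal :=
  Int.absNorm_under_mem _

lemma card_fiber_le (p : Nat.Primes) (T : Finset (HeightOneSpectrum (𝓞 K)))
    (hT : ∀ v ∈ T, ratPrime K v = p) : T.card ≤ Module.finrank ℚ K := by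
  classical
  have hp := p.2
  have h1 : ∏ I ∈ T.image (fun v => v.asIdeal), I ∣ Ideal.span {((p : ℕ) : 𝓞 K)} := by
    apply Finset.prod_primes_dvd
    · intro I hI
      obtain ⟨v, _, rfl⟩ := Finset.mem_image.1 hI
      exact v.prime
    · intro I hI
      obtain ⟨v, hv, rfl⟩ := Finset.mem_image.1 hI
      rw [Ideal.dvd_span_singleton, ← hT v hv]
      exact ratPrime_mem K v
  rw [Finset.prod_image (fun v _ v' _ h => HeightOneSpectrum.ext h)] at h1
  have h2 := map_dvd Ideal.absNorm h1
  have h3 : Ideal.absNorm (Ideal.span {((p : ℕ) : 𝓞 K)}) = (p : ℕ) ^ Module.finrank ℚ K := by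
    have := Ideal.absNorm_span_singleton ((p : ℕ) : 𝓞 K)
    rw [this]
    have h := Algebra.norm_algebraMap (S := 𝓞 K) ((p : ℕ) : ℤ)
    rw [RingOfIntegers.rank] at h
    simp only [map_natCast] at h
    rw [h, Int.natAbs_pow, Int.natAbs_natCast]
  rw [h3, map_prod] at h2
  have h4 : (p : ℕ) ^ T.card ∣ ∏ v ∈ T, Ideal.absNorm v.asIdeal := by
    rw [← Finset.prod_const]
    apply Finset.prod_dvd_prod_of_dvd
    intro v hv
    obtain ⟨f, hf, h⟩ := absNorm_eq_ratPrime_pow K v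
    rw [h, hT v hv]
    exact dvd_pow_self _ (by omega)
  exact (Nat.pow_dvd_pow_iff_le_right hp.one_lt).1 (h4.trans h2)

lemma finite_fiber (p : Nat.Primes) : Finite {v : HeightOneSpectrum (𝓞 K) // ratPrime K v = p} := by
  classical
  by_contra h
  rw [not_finite_iff_infinite] at h
  obtain ⟨T, hT⟩ := Infinite.exists_subset_card_eq {v : HeightOneSpectrum (𝓞 K) // ratPrime K v = p}
    (Module.finrank ℚ K + 1)
  have := card_fiber_le K p (T.map (Function.Embedding.subtype _)) (by
    intro v hv
    obtain ⟨x, _, rfl⟩ := Finset.mem_map.1 hv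
    exact x.2)
  rw [Finset.card_map] at this
  omega

lemma numId_prime_eq (p : Nat.Primes) : numId K p =
    Nat.card {v : {v : HeightOneSpectrum (𝓞 K) // ratPrime K v = p} //
      Ideal.absNorm v.1.asIdeal = p} := by
  unfold numId
  refine (Nat.card_congr (Equiv.ofBijective (fun v => ⟨v.1.1.asIdeal, v.2⟩) ⟨?_, ?_⟩)).symm
  · intro v v' h
    have := congrArg Subtype.val h
    exact Subtype.ext (Subtype.ext (HeightOneSpectrum.ext this))
  · rintro ⟨I, hI⟩
    have hp := p.2
    have hpr : I.IsPrime := Ideal.isPrime_of_irreducible_absNorm (by rw [hI]; exact hp)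
    have hne : I ≠ ⊥ := by
      rintro rfl
      simp at hI
      exact hp.ne_zero hI.symm
    let v : HeightOneSpectrum (𝓞 K) := ⟨I, hpr, hne⟩
    refine ⟨⟨⟨v, ?_⟩, hI⟩, rfl⟩
    obtain ⟨f, hf, h⟩ := absNorm_eq_ratPrime_pow K v
    have h5 : (ratPrime K v : ℕ) ∣ p := by
      rw [← hI]
      change _ ∣ Ideal.absNorm v.asIdeal
      rw [h]; exact dvd_pow_self _ (by omega)
    exact Subtype.ext ((Nat.prime_dvd_prime_iff_eq (ratPrime K v).2 hp).1 h5)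

lemma fiber_sum {s : ℝ} (hs : 1 < s) (p : Nat.Primes) :
    numId K p * (p : ℝ) ^ (-s) ≤
      ∑' v : {v : HeightOneSpectrum (𝓞 K) // ratPrime K v = p}, normW K s v.1.asIdeal ∧
    ∑' v : {v : HeightOneSpectrum (𝓞 K) // ratPrime K v = p}, normW K s v.1.asIdeal ≤
     numId K p * (p : ℝ) ^ (-s) + Module.finrank ℚ K * (p : ℝ) ^ (-2 : ℝ) := by
  classical
  have := finite_fiber K p
  have : Fintype {v : HeightOneSpectrum (𝓞 K) // ratPrime K v = p} := Fintype.ofFinite _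
  have hp := p.2
  have hp1 : (1 : ℝ) ≤ (p : ℕ) := by exact_mod_cast hp.one_lt.le
  rw [tsum_fintype]
  have hsum : (numId K p : ℝ) * (p : ℝ) ^ (-s) =
      ∑ v : {v : HeightOneSpectrum (𝓞 K) // ratPrime K v = p},
        if Ideal.absNorm v.1.asIdeal = p then (p : ℝ) ^ (-s) else 0 := by
    rw [← Finset.sum_filter, Finset.sum_const, nsmul_eq_mul, numId_prime_eq K p,
      Nat.card_eq_fintype_card, Fintype.card_subtype]
  constructor
  · rw [hsum]
    refine Finset.sum_le_sum fun v _ => ?_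
    split_ifs with h
    · rw [normW_apply, h]
    · exact normW_nonneg _ _ _
  · have hcard : (Fintype.card {v : HeightOneSpectrum (𝓞 K) // ratPrime K v = p} : ℝ) ≤
        Module.finrank ℚ K := by
      have := card_fiber_le K p (Finset.univ.map (Function.Embedding.subtype
        (fun v : HeightOneSpectrum (𝓞 K) => ratPrime K v = p))) (by
        intro v hv
        obtain ⟨x, _, rfl⟩ := Finset.mem_map.1 hv
        exact x.2)
      rw [Finset.card_map, Finset.card_univ] at this
      exact_mod_cast this
    have : (Fintype.card {v : HeightOneSpectrum (𝓞 K) // ratPrime K v = p} : ℝ) *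
        (p : ℝ) ^ (-2 : ℝ) ≤ Module.finrank ℚ K * (p : ℝ) ^ (-2 : ℝ) :=
      mul_le_mul_of_nonneg_right hcard (by positivity)
    refine le_trans ?_ (add_le_add_right this _)
    rw [hsum, ← nsmul_eq_mul, ← Finset.card_univ, ← Finset.sum_const, ← Finset.sum_add_distrib]
    refine Finset.sum_le_sum fun v _ => ?_
    obtain ⟨f, hf, h⟩ := absNorm_eq_ratPrime_pow K v.1
    rw [v.2] at h
    rw [normW_apply]
    split_ifs with h'
    · rw [h']
      have : (0 : ℝ) ≤ (p : ℝ) ^ (-2 : ℝ) := by positivity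
      linarith
    · have hf2 : 2 ≤ f := by
        by_contra hc
        have : f = 1 := by omega
        rw [this, pow_one] at h
        exact h' h
      rw [zero_add, h, Nat.cast_pow, ← Real.rpow_natCast, ← Real.rpow_mul (by positivity)]
      apply Real.rpow_le_rpow_of_exponent_le hp1
      have : (2 : ℝ) ≤ f := by exact_mod_cast hf2
      nlinarith

/-- The sum over rational primes weighted by the number of degree one primes. -/
lemma degOne_log : ∃ C : ℝ, ∀ᶠ s : ℝ in 𝓝[>] 1,
    Summable (fun p : Nat.Primes => (numId K p : ℝ) * (p : ℝ) ^ (-s)) ∧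
    |∑' p : Nat.Primes, (numId K p : ℝ) * (p : ℝ) ^ (-s) + Real.log (s - 1)| ≤ C := by
  obtain ⟨C, hC⟩ := zeta_eventually K
  have hsq : Summable (fun v : HeightOneSpectrum (𝓞 K) => normW K 2 v.asIdeal) := by
    obtain ⟨s, hs1, hs2, hs, _⟩ := hC.exists
    refine Summable.of_nonneg_of_le (fun v => normW_nonneg _ _ _) (fun v => ?_)
      (hs.comp_injective HeightOneSpectrum_asIdeal_injective)
    simp only [Function.comp_apply, normW_apply]
    apply Real.rpow_le_rpow_of_exponent_le
    · have := two_le_absNorm K v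
      exact_mod_cast (by omega : 1 ≤ Ideal.absNorm v.asIdeal)
    · linarith
  have hpp : Summable (fun p : Nat.Primes => (Module.finrank ℚ K : ℝ) * (p : ℝ) ^ (-2 : ℝ)) :=
    (Nat.Primes.summable_rpow.2 (by norm_num)).mul_left _
  refine ⟨C + 2 * ∑' v : HeightOneSpectrum (𝓞 K), normW K 2 v.asIdeal +
    ∑' p : Nat.Primes, (Module.finrank ℚ K : ℝ) * (p : ℝ) ^ (-2 : ℝ), ?_⟩
  filter_upwards [hC] with s ⟨hs1, hs2, hs, hb⟩
  have hsv : Summable (fun v : HeightOneSpectrum (𝓞 K) => normW K s v.asIdeal) :=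
    hs.comp_injective HeightOneSpectrum_asIdeal_injective
  have hE := euler_log (normW K s) (normW_nonneg K s) (normW_bot K (by linarith)) hs (by
    intro v
    have h2 := two_le_absNorm K v
    have h2' : (2 : ℝ) ≤ Ideal.absNorm v.asIdeal := by exact_mod_cast h2
    rw [normW_apply]
    calc (Ideal.absNorm v.asIdeal : ℝ) ^ (-s) ≤ (Ideal.absNorm v.asIdeal : ℝ) ^ (-1 : ℝ) :=
          Real.rpow_le_rpow_of_exponent_le (by linarith) (by linarith)
      _ ≤ 1 / 2 := by
          rw [Real.rpow_neg_one, one_div]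
          exact inv_anti₀ (by norm_num) h2')
  have hsq' : ∑' v : HeightOneSpectrum (𝓞 K), normW K s v.asIdeal ^ 2 ≤
      ∑' v : HeightOneSpectrum (𝓞 K), normW K 2 v.asIdeal := by
    have hle : ∀ v : HeightOneSpectrum (𝓞 K), normW K s v.asIdeal ^ 2 ≤ normW K 2 v.asIdeal := by
      intro v
      have h2 := two_le_absNorm K v
      rw [normW_apply, normW_apply, ← Real.rpow_natCast, ← Real.rpow_mul (by positivity)]
      apply Real.rpow_le_rpow_of_exponent_le
      · exact_mod_cast (by omega : 1 ≤ Ideal.absNorm v.asIdeal)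
      · push_cast; linarith
    exact (Summable.of_nonneg_of_le (fun v => by positivity) hle hsq).tsum_le_tsum hle hsq
  have hσ : Summable (fun x : (Σ p : Nat.Primes, {v : HeightOneSpectrum (𝓞 K) // ratPrime K v = p}) =>
      normW K s x.2.1.asIdeal) := (Equiv.sigmaFiberEquiv (ratPrime K)).summable_iff.2 hsv
  have hV : ∑' v : HeightOneSpectrum (𝓞 K), normW K s v.asIdeal = ∑' p : Nat.Primes,
      ∑' v : {v : HeightOneSpectrum (𝓞 K) // ratPrime K v = p}, normW K s v.1.asIdeal := by
    rw [← (Equiv.sigmaFiberEquiv (ratPrime K)).tsum_eq]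
    exact hσ.tsum_sigma
  have hF : Summable (fun p : Nat.Primes =>
      ∑' v : {v : HeightOneSpectrum (𝓞 K) // ratPrime K v = p}, normW K s v.1.asIdeal) := hσ.sigma
  have hN : Summable (fun p : Nat.Primes => (numId K p : ℝ) * (p : ℝ) ^ (-s)) :=
    Summable.of_nonneg_of_le (fun p => by positivity) (fun p => (fiber_sum K hs1 p).1) hF
  refine ⟨hN, ?_⟩
  have u1 := hN.tsum_le_tsum (fun p => (fiber_sum K hs1 p).1) hF
  have u2 := hF.tsum_le_tsum (fun p => (fiber_sum K hs1 p).2) (hN.add hpp)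
  rw [hN.tsum_add hpp] at u2
  rw [← hV] at u1 u2
  rw [abs_le] at hE hb ⊢
  have : 0 ≤ ∑' p : Nat.Primes, (Module.finrank ℚ K : ℝ) * (p : ℝ) ^ (-2 : ℝ) :=
    tsum_nonneg fun p => by positivity
  constructor <;> linarith [hE.1, hE.2, hb.1, hb.2]

end ZetaBounds
section Combine
open Filter Topology

lemma exists_prime_comb {ι : Type*} [Finite ι] (K : ι → Type*) [∀ i, Field (K i)]
    [∀ i, NumberField (K i)] (b : ι → ℝ) (hb : 0 < ∑ᶠ i, b i) (B : Set Nat.Primes)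
    (hB : B.Finite) : ∃ p : Nat.Primes, p ∉ B ∧ 0 < ∑ᶠ i, b i * (numId (K i) p : ℝ) := by
  classical
  have : Fintype ι := Fintype.ofFinite ι
  rw [finsum_eq_sum_of_fintype] at hb
  by_contra! hcon
  simp_rw [finsum_eq_sum_of_fintype] at hcon
  choose C hC using fun i => degOne_log (K i)
  have hall : ∀ᶠ s : ℝ in 𝓝[>] 1, ∀ i, 
    Summable (fun p : Nat.Primes => (numId (K i) p : ℝ) * (p : ℝ) ^ (-s)) ∧
    |∑' p : Nat.Primes, (numId (K i) p : ℝ) * (p : ℝ) ^ (-s) + Real.log (s - 1)| ≤ C i :=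
    eventually_all.2 hC
  have hgt : ∀ᶠ s : ℝ in 𝓝[>] 1, 1 < s := eventually_mem_nhdsWithin
  set D : ℝ := ∑ i, |b i| * C i with hD
  set E : ℝ := ∑ p ∈ hB.toFinset, |∑ i, b i * (numId (K i) p : ℝ)| with hE
  have hlog : Tendsto (fun s : ℝ => (∑ i, b i) * Real.log (s - 1)) (𝓝[>] 1) atBot := by
    apply Tendsto.const_mul_atBot hb
    apply Real.tendsto_log_nhdsGT_zero.comp
    have h1 : Tendsto (fun s : ℝ => s - 1) (𝓝[>] 1) (𝓝 (1 - 1)) :=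
      ((continuous_id.sub continuous_const).tendsto 1).mono_left nhdsWithin_le_nhds
    rw [sub_self] at h1
    refine tendsto_nhdsWithin_iff.2 ⟨h1, ?_⟩
    filter_upwards [hgt] with s hs
    simpa using hs
  obtain ⟨s, hs, hs1, hs2⟩ := (hall.and (hgt.and (hlog.eventually_lt_atBot (-(D + E) - 1)))).exists
  -- the combined sum
  have hsumm : ∀ i, Summable (fun p : Nat.Primes => b i * ((numId (K i) p : ℝ) * (p : ℝ) ^ (-s))) :=
    fun i => (hs i).1.mul_left _
  have hS : ∑ i, b i * ∑' p : Nat.Primes, (numId (K i) p : ℝ) * (p : ℝ) ^ (-s) =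
      ∑' p : Nat.Primes, (∑ i, b i * (numId (K i) p : ℝ)) * (p : ℝ) ^ (-s) := by
    simp_rw [← tsum_mul_left]
    rw [← Summable.tsum_finsetSum (fun i _ => hsumm i)]
    refine tsum_congr fun p => ?_
    rw [Finset.sum_mul]
    exact Finset.sum_congr rfl fun i _ => by ring
  have hS1 : Summable (fun p : Nat.Primes => (∑ i, b i * (numId (K i) p : ℝ)) * (p : ℝ) ^ (-s)) := by
    refine (summable_sum (s := Finset.univ) (fun i _ => hsumm i)).congr fun p => ?_
    rw [Finset.sum_mul]
    exact Finset.sum_congr rfl fun i _ => by ring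
  have hup : ∑' p : Nat.Primes, (∑ i, b i * (numId (K i) p : ℝ)) * (p : ℝ) ^ (-s) ≤ E := by
    have h0 : ∀ p : Nat.Primes, (∑ i, b i * (numId (K i) p : ℝ)) * (p : ℝ) ^ (-s) ≤
        if p ∈ hB.toFinset then |∑ i, b i * (numId (K i) p : ℝ)| else 0 := by
      intro p
      have hp1 : (1 : ℝ) ≤ (p : ℕ) := by exact_mod_cast p.2.one_lt.le
      have hle : (p : ℝ) ^ (-s) ≤ 1 := Real.rpow_le_one_of_one_le_of_nonpos hp1 (by linarith)
      have hnn : (0 : ℝ) ≤ (p : ℝ) ^ (-s) := by positivity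
      split_ifs with hp
      · calc _ ≤ |∑ i, b i * (numId (K i) p : ℝ)| * (p : ℝ) ^ (-s) :=
              mul_le_mul_of_nonneg_right (le_abs_self _) hnn
          _ ≤ |∑ i, b i * (numId (K i) p : ℝ)| * 1 :=
              mul_le_mul_of_nonneg_left hle (abs_nonneg _)
          _ = _ := mul_one _
      · exact mul_nonpos_of_nonpos_of_nonneg (hcon p (by simpa using hp)) hnn
    have h1 := hasSum_sum_of_ne_finset_zero (L := .unconditional _) (s := hB.toFinset)
      (f := fun p => if p ∈ hB.toFinset then |∑ i, b i * (numId (K i) p : ℝ)| else 0)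
      (fun p hp => if_neg hp)
    have h2 := hS1.tsum_le_tsum h0 h1.summable
    rw [h1.tsum_eq] at h2
    refine h2.trans (le_of_eq ?_)
    rw [hE]
    exact Finset.sum_congr rfl fun p hp => if_pos hp
  have hlow : -D ≤ ∑ i, b i * (∑' p : Nat.Primes, (numId (K i) p : ℝ) * (p : ℝ) ^ (-s) +
      Real.log (s - 1)) := by
    rw [hD, ← Finset.sum_neg_distrib]
    refine Finset.sum_le_sum fun i _ => ?_
    have := mul_le_mul_of_nonneg_left (hs i).2 (abs_nonneg (b i))
    rw [← abs_mul] at this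
    linarith [neg_abs_le (b i * (∑' p : Nat.Primes, (numId (K i) p : ℝ) * (p : ℝ) ^ (-s) +
      Real.log (s - 1)))]
  simp_rw [mul_add] at hlow
  rw [Finset.sum_add_distrib, hS, ← Finset.sum_mul] at hlow
  linarith

lemma moebius_div_pos (m : ℕ) (hm : 0 < m) :
    0 < ∑ d ∈ m.divisors, (ArithmeticFunction.moebius d : ℝ) / d := by
  have h := (ArithmeticFunction.sum_eq_iff_sum_mul_moebius_eq (R := ℝ)
    (f := fun n => (Nat.totient n : ℝ)) (g := fun n => (n : ℝ))).1 (by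
      intro n hn
      exact_mod_cast Nat.sum_totient n) m hm
  have h2 : (m : ℝ) * ∑ d ∈ m.divisors, (ArithmeticFunction.moebius d : ℝ) / d =
      (Nat.totient m : ℝ) := by
    rw [← h, ← Nat.map_div_right_divisors, Finset.sum_map, Finset.mul_sum]
    refine Finset.sum_congr rfl fun d hd => ?_
    have hd' := Nat.dvd_of_mem_divisors hd
    have : d ≠ 0 := by rintro rfl; simp at hd
    change _ = (ArithmeticFunction.moebius d : ℝ) * ((m / d : ℕ) : ℝ)
    rw [Nat.cast_div hd' (by exact_mod_cast this)]
    ring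
  have h3 : (0 : ℝ) < Nat.totient m := by exact_mod_cast Nat.totient_pos.2 hm
  have h4 : (0 : ℝ) < m := by exact_mod_cast hm
  rw [← h2] at h3
  exact (mul_pos_iff_of_pos_left h4).1 h3

lemma moebius_sum_coprime (m k : ℕ) (hm : 0 < m)
    (h : 0 < ∑ d ∈ m.divisors, (ArithmeticFunction.moebius d : ℝ) * (if d ∣ k then 1 else 0)) :
    m.Coprime k := by
  have hg : 0 < m.gcd k := Nat.gcd_pos_of_pos_left _ hm
  have h1 : ∑ d ∈ m.divisors, (ArithmeticFunction.moebius d : ℝ) * (if d ∣ k then 1 else 0) =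
      ((∑ d ∈ (m.gcd k).divisors, ArithmeticFunction.moebius d : ℤ) : ℝ) := by
    have : (m.gcd k).divisors = m.divisors.filter (· ∣ k) := by
      ext d
      simp [Nat.mem_divisors, Nat.dvd_gcd_iff, hm.ne']
    rw [this, Finset.sum_filter]
    push_cast
    exact Finset.sum_congr rfl fun d _ => by split_ifs <;> simp
  rw [h1] at h
  by_contra hc
  have h2 : ∑ d ∈ (m.gcd k).divisors, ArithmeticFunction.moebius d = 0 := by
    rw [← ArithmeticFunction.coe_mul_zeta_apply, ArithmeticFunction.moebius_mul_coe_zeta]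
    exact ArithmeticFunction.one_apply_ne hc
  rw [h2] at h
  simp at h
end Combine

open Polynomial NumberField IntermediateField

section B
variable {K : Type*} [Field K] [NumberField K]

lemma bad_primes_finite (x : 𝓞 K) (hx : x ≠ 0) :
    {p : Nat.Primes | ∃ Q : Ideal (𝓞 K), Q ≠ ⊤ ∧ ((p : ℕ) : 𝓞 K) ∈ Q ∧ x ∈ Q}.Finite := by
  set m := Ideal.absNorm (Ideal.span {x}) with hm
  have hm0 : m ≠ 0 := by
    rw [hm, Ne, Ideal.absNorm_eq_zero_iff, Ideal.span_singleton_eq_bot]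
    exact hx
  have hfin : {p : Nat.Primes | (p : ℕ) ∣ m}.Finite := by
    have : ((fun p : Nat.Primes => (p : ℕ)) ⁻¹' (m.divisors : Set ℕ)).Finite :=
      Set.Finite.preimage (Subtype.val_injective.injOn) (Finset.finite_toSet _)
    refine this.subset ?_
    intro p hp
    simpa [hm0] using hp
  refine hfin.subset ?_
  rintro p ⟨Q, hQ, hp, hxQ⟩
  by_contra hnd
  have hcop : Nat.Coprime (p : ℕ) m := (Nat.Prime.coprime_iff_not_dvd p.2).2 hnd
  have hmQ : (m : 𝓞 K) ∈ Q := by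
    have := Ideal.absNorm_mem (Ideal.span {x})
    exact (Ideal.span_singleton_le_iff_mem Q).2 hxQ this
  apply hQ
  rw [Ideal.eq_top_iff_one]
  have h1 := Nat.isCoprime_iff_coprime.2 hcop
  obtain ⟨a, b, hab⟩ := h1
  have : (1 : 𝓞 K) = (a : 𝓞 K) * ((p : ℕ) : 𝓞 K) + (b : 𝓞 K) * (m : 𝓞 K) := by
    have := congrArg (Int.cast : ℤ → 𝓞 K) hab
    push_cast at this
    exact this.symm
  rw [this]
  exact Q.add_mem (Q.mul_mem_left _ hp) (Q.mul_mem_left _ hmQ)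

lemma norm_prime_int {p : ℕ} (hp : p.Prime) (Q : Ideal (𝓞 K)) (h : Ideal.absNorm Q = p)
    (x : 𝓞 K) : ∃ k : ℤ, x - k ∈ Q := by
  have hcard : Nat.card (𝓞 K ⧸ Q) = p := h
  have := Fact.mk hp
  have hne : (1 : 𝓞 K ⧸ Q) ≠ 0 := by
    intro h1
    have : Q = ⊤ := by
      rw [Ideal.eq_top_iff_one]
      exact Ideal.Quotient.eq_zero_iff_mem.1 (by simpa using h1)
    rw [this, Ideal.absNorm_top] at h
    exact hp.one_lt.ne h
  have := zmultiples_eq_top_of_prime_card hcard hne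
  have hx : Ideal.Quotient.mk Q x ∈ AddSubgroup.zmultiples (1 : 𝓞 K ⧸ Q) := by
    rw [this]; trivial
  obtain ⟨k, hk⟩ := hx
  refine ⟨k, ?_⟩
  rw [← Ideal.Quotient.eq_zero_iff_mem, map_sub, ← hk]
  simp

lemma card_le_of_pow_eq {R : Type*} [CommRing R] [IsDomain R] [Fintype R] {p : ℕ} (hp : 1 < p)
    (h : ∀ x : R, x ^ p = x) : Fintype.card R ≤ p := by
  classical
  letI : Field R := Fintype.fieldOfDomain R
  have hne : (X ^ p - X : R[X]) ≠ 0 := FiniteField.X_pow_card_sub_X_ne_zero _ hp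
  have : (Finset.univ : Finset R).val ≤ (X ^ p - X : R[X]).roots := by
    rw [Multiset.le_iff_subset Finset.univ.nodup]
    intro y _
    rw [mem_roots hne]
    simp only [IsRoot.def, eval_sub, eval_pow, eval_X]
    rw [h y, sub_self]
  have h2 := Multiset.card_le_card this
  have h3 := card_roots' (X ^ p - X : R[X])
  rw [FiniteField.X_pow_card_sub_X_natDegree_eq _ hp] at h3
  have h4 : Multiset.card (Finset.univ : Finset R).val = Fintype.card R := rfl
  omega

lemma norm_prime_iff {p : ℕ} (hp : p.Prime) (Q : Ideal (𝓞 K)) [hQ : Q.IsPrime] :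
    Ideal.absNorm Q = p ↔ ((p : 𝓞 K) ∈ Q ∧ ∀ x : 𝓞 K, x ^ p - x ∈ Q) := by
  have := Fact.mk hp
  constructor
  · intro h
    have hpQ : (p : 𝓞 K) ∈ Q := by
      have := Ideal.absNorm_mem Q
      rwa [h] at this
    refine ⟨hpQ, fun x => ?_⟩
    obtain ⟨k, hk⟩ := norm_prime_int hp Q h x
    have h1 : x ^ p - (k : 𝓞 K) ^ p ∈ Q := Q.mem_of_dvd (sub_dvd_pow_sub_pow x _ p) hk
    have h2 : ((k : 𝓞 K) ^ p - k) ∈ Q := by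
      have : (p : ℤ) ∣ k ^ p - k := by
        rw [← ZMod.intCast_zmod_eq_zero_iff_dvd]
        push_cast
        rw [ZMod.pow_card, sub_self]
      obtain ⟨c, hc⟩ := this
      have := congrArg (Int.cast : ℤ → 𝓞 K) hc
      push_cast at this
      rw [this]
      exact Q.mul_mem_right _ hpQ
    have : x ^ p - x = (x ^ p - (k : 𝓞 K) ^ p) + ((k : 𝓞 K) ^ p - k) - (x - k) := by ring
    rw [this]
    exact Q.sub_mem (Q.add_mem h1 h2) hk
  · rintro ⟨hpQ, hx⟩
    have hQ0 : Q ≠ ⊥ := by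
      rintro rfl
      have : (p : 𝓞 K) = 0 := by simpa using hpQ
      exact hp.ne_zero (by exact_mod_cast this)
    have := Ideal.finiteQuotientOfFreeOfNeBot Q hQ0
    have := Fintype.ofFinite (𝓞 K ⧸ Q)
    have hcard : Ideal.absNorm Q = Fintype.card (𝓞 K ⧸ Q) := by
      rw [← Nat.card_eq_fintype_card]; rfl
    have hle : Fintype.card (𝓞 K ⧸ Q) ≤ p := by
      apply card_le_of_pow_eq hp.one_lt
      intro y
      obtain ⟨x, rfl⟩ := Ideal.Quotient.mk_surjective y
      rw [← sub_eq_zero, ← map_pow, ← map_sub, Ideal.Quotient.eq_zero_iff_mem]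
      exact hx x
    have hdvd : p ∣ Fintype.card (𝓞 K ⧸ Q) := by
      have h0 : ((p : ℕ) : 𝓞 K ⧸ Q) = 0 := by
        rw [← map_natCast (Ideal.Quotient.mk Q), Ideal.Quotient.eq_zero_iff_mem]
        exact hpQ
      have hord : addOrderOf (1 : 𝓞 K ⧸ Q) = p := by
        apply addOrderOf_eq_prime
        · simpa using h0
        · exact one_ne_zero
      rw [← hord]
      exact addOrderOf_dvd_card
    rw [hcard]
    exact le_antisymm hle (Nat.le_of_dvd Fintype.card_pos hdvd)

end B

open Polynomial NumberField IntermediateField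
section B2
open scoped Pointwise
variable {K : Type*} [Field K] [NumberField K]
variable {N : Type*} [Field N] [NumberField N] [Algebra K N] [IsGalois K N]

lemma exists_moved (τ : N ≃ₐ[K] N) (h : τ ≠ 1) : ∃ x : 𝓞 N, τ • x - x ≠ 0 := by
  by_contra! hc
  apply h
  ext y
  obtain ⟨a, b, hb, rfl⟩ := IsFractionRing.div_surjective (A := 𝓞 N) y
  have key : ∀ a : 𝓞 N, τ (algebraMap (𝓞 N) N a) = algebraMap (𝓞 N) N a := by
    intro a
    have := congrArg (algebraMap (𝓞 N) N) (hc a)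
    rw [map_sub, map_zero, sub_eq_zero] at this
    exact this
  rw [map_div₀, key, key]
  rfl

lemma card_fiber_of_mem {p : ℕ} (hp : p.Prime) (q : Ideal (𝓞 K))
    (good : ∀ τ : N ≃ₐ[K] N, τ ≠ 1 → ∃ x : 𝓞 N, ∀ Q : Ideal (𝓞 N), Q ≠ ⊤ → (p : 𝓞 N) ∈ Q →
      τ • x - x ∉ Q)
    (Q₀ : Ideal (𝓞 N)) (h0 : Ideal.absNorm Q₀ = p) (h0q : Q₀.under (𝓞 K) = q) :
    Nat.card {Q : Ideal (𝓞 N) // Ideal.absNorm Q = p ∧ Q.under (𝓞 K) = q} =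
      Module.finrank K N := by
  have hpr : ∀ Q : Ideal (𝓞 N), Ideal.absNorm Q = p → Q.IsPrime := fun Q h =>
    Ideal.isPrime_of_irreducible_absNorm (by rw [h]; exact hp)
  have := hpr Q₀ h0
  have hmem : ∀ (τ : N ≃ₐ[K] N) (x : 𝓞 N) (Q : Ideal (𝓞 N)), x ∈ τ • Q ↔ τ⁻¹ • x ∈ Q :=
    fun τ x Q => Ideal.mem_pointwise_smul_iff_inv_smul_mem
  have hnorm : ∀ τ : N ≃ₐ[K] N, Ideal.absNorm (τ • Q₀) = p := by
    intro τ
    rw [norm_prime_iff hp]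
    obtain ⟨h1, h2⟩ := (norm_prime_iff hp Q₀).1 h0
    refine ⟨?_, fun x => ?_⟩
    · rw [hmem]
      have : τ⁻¹ • (p : 𝓞 N) = p := by
        exact map_natCast (MulSemiringAction.toRingHom (N ≃ₐ[K] N) (𝓞 N) τ⁻¹) p
      rwa [this]
    · rw [hmem, smul_sub, smul_pow']
      exact h2 _
  have hunder : ∀ τ : N ≃ₐ[K] N, (τ • Q₀).under (𝓞 K) = q := by
    intro τ
    rw [← h0q]
    exact Ideal.under_smul (𝓞 K) Q₀ τ
  rw [← IsGalois.card_aut_eq_finrank]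
  symm
  apply Nat.card_congr
  refine Equiv.ofBijective (fun τ => ⟨τ • Q₀, hnorm τ, hunder τ⟩) ⟨?_, ?_⟩
  · intro τ₁ τ₂ h
    simp only [Subtype.mk.injEq] at h
    by_contra hne
    have hne' : τ₂⁻¹ * τ₁ ≠ 1 := fun h => hne (by rwa [inv_mul_eq_one, eq_comm] at h)
    obtain ⟨x, hx⟩ := good _ hne'
    have hst : (τ₂⁻¹ * τ₁) • Q₀ = Q₀ := by
      rw [mul_smul, h, ← mul_smul, inv_mul_cancel, one_smul]
    refine hx Q₀ (hpr _ h0).ne_top ((norm_prime_iff hp Q₀).1 h0).1 ?_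
    obtain ⟨k, hk⟩ := norm_prime_int hp Q₀ h0 x
    have h3 : (τ₂⁻¹ * τ₁) • (x - k) ∈ Q₀ := by
      nth_rw 1 [← hst]
      exact Ideal.smul_mem_pointwise_smul _ _ _ hk
    rw [smul_sub] at h3
    have h4 : (τ₂⁻¹ * τ₁) • (k : 𝓞 N) = k :=
      map_intCast (MulSemiringAction.toRingHom (N ≃ₐ[K] N) (𝓞 N) (τ₂⁻¹ * τ₁)) k
    rw [h4] at h3
    have := Q₀.sub_mem h3 hk
    simpa using this
  · rintro ⟨Q, hQ, hQq⟩
    have := hpr Q hQ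
    obtain ⟨τ, hτ⟩ := Algebra.IsInvariant.exists_smul_of_under_eq (𝓞 K) (𝓞 N) (N ≃ₐ[K] N) Q₀ Q
      (by rw [h0q]; exact hQq.symm)
    exact ⟨τ, by simp [hτ]⟩
end B2

open Polynomial NumberField IntermediateField
section B3
open scoped Pointwise
variable {K : Type*} [Field K] [NumberField K]
variable {L : Type*} [Field L] [NumberField L] [Algebra K L] [IsGalois K L]

open Classical in
lemma card_fiber_eq {p : ℕ} (hp : p.Prime) (q : Ideal (𝓞 K))
    (P : Ideal (𝓞 L)) [P.IsPrime] (hPq : P.under (𝓞 K) = q) (hpP : (p : 𝓞 L) ∈ P)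
    (φ : L ≃ₐ[K] L) (hφ : ∀ x : 𝓞 L, φ • x - x ^ p ∈ P)
    (N : IntermediateField K L) [IsGalois K N]
    (good : ∀ τ : N ≃ₐ[K] N, τ ≠ 1 → ∃ x : 𝓞 N, ∀ Q : Ideal (𝓞 N), Q ≠ ⊤ → (p : 𝓞 N) ∈ Q →
      τ • x - x ∉ Q) :
    Nat.card {Q : Ideal (𝓞 N) // Ideal.absNorm Q = p ∧ Q.under (𝓞 K) = q} =
      if φ ∈ N.fixingSubgroup then Module.finrank K N else 0 := by
  have hQ0u : (P.under (𝓞 N)).under (𝓞 K) = q := by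
    rw [Ideal.under_under]; exact hPq
  have hQ0p : (p : 𝓞 N) ∈ P.under (𝓞 N) := by
    rw [Ideal.mem_under, map_natCast]; exact hpP
  split_ifs with h
  · apply card_fiber_of_mem hp q good (P.under (𝓞 N)) _ hQ0u
    rw [norm_prime_iff hp]
    refine ⟨hQ0p, fun x => ?_⟩
    rw [Ideal.mem_under, map_sub, map_pow]
    have h1 := hφ (algebraMap (𝓞 N) (𝓞 L) x)
    have h2 : φ • (algebraMap (𝓞 N) (𝓞 L) x) = algebraMap (𝓞 N) (𝓞 L) x := by
      apply RingOfIntegers.ext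
      exact (mem_fixingSubgroup_iff N φ).1 h (x : N) (x : N).2
    rw [h2] at h1
    rw [← neg_sub]
    exact P.neg_mem h1
  · have : IsEmpty {Q : Ideal (𝓞 N) // Ideal.absNorm Q = p ∧ Q.under (𝓞 K) = q} := by
      constructor
      rintro ⟨Q, hQ, hQq⟩
      have : Q.IsPrime := Ideal.isPrime_of_irreducible_absNorm (by rw [hQ]; exact hp)
      obtain ⟨τ, hτ⟩ := Algebra.IsInvariant.exists_smul_of_under_eq (𝓞 K) (𝓞 N) (N ≃ₐ[K] N) Q
        (P.under (𝓞 N)) (by rw [hQ0u]; exact hQq)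
      have h0 : ∀ x : 𝓞 N, x ^ p - x ∈ P.under (𝓞 N) := by
        intro x
        rw [hτ, Ideal.mem_pointwise_smul_iff_inv_smul_mem, smul_sub, smul_pow']
        exact ((norm_prime_iff hp Q).1 hQ).2 _
      have hne : φ.restrictNormal N ≠ 1 := by
        intro h1
        apply h
        refine (mem_fixingSubgroup_iff N φ).2 ?_
        intro x hx
        have := AlgEquiv.restrictNormal_commutes φ N ⟨x, hx⟩
        rw [h1] at this
        exact this.symm
      obtain ⟨x, hx⟩ := good _ hne
      refine hx (P.under (𝓞 N)) (Ideal.IsPrime.ne_top inferInstance) hQ0p ?_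
      have h1 := hφ (algebraMap (𝓞 N) (𝓞 L) x)
      have h2 := h0 x
      rw [Ideal.mem_under, map_sub, map_pow] at h2
      have h3 := P.add_mem h1 h2
      rw [sub_add_sub_cancel] at h3
      rw [Ideal.mem_under, map_sub]
      convert h3 using 2
      apply RingOfIntegers.ext
      exact AlgEquiv.restrictNormal_commutes φ N (x : N)
    exact Nat.card_of_isEmpty

lemma numId_fiber {p : ℕ} (hp : p.Prime) (N : Type*) [Field N] [NumberField N] [Algebra K N] :
    numId N p = ∑ᶠ q : {q : Ideal (𝓞 K) // Ideal.absNorm q = p},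
      Nat.card {Q : Ideal (𝓞 N) // Ideal.absNorm Q = p ∧ Q.under (𝓞 K) = q} := by
  have hf : ∀ Q : {Q : Ideal (𝓞 N) // Ideal.absNorm Q = p},
      Ideal.absNorm ((Q : Ideal (𝓞 N)).under (𝓞 K)) = p := by
    rintro ⟨Q, hQ⟩
    have : Q.IsPrime := Ideal.isPrime_of_irreducible_absNorm (by rw [hQ]; exact hp)
    obtain ⟨h1, h2⟩ := (norm_prime_iff hp Q).1 hQ
    rw [norm_prime_iff hp]
    refine ⟨?_, fun x => ?_⟩
    · rw [Ideal.mem_under, map_natCast]; exact h1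
    · rw [Ideal.mem_under, map_sub, map_pow]; exact h2 _
  let f : {Q : Ideal (𝓞 N) // Ideal.absNorm Q = p} → {q : Ideal (𝓞 K) // Ideal.absNorm q = p} :=
    fun Q => ⟨(Q : Ideal (𝓞 N)).under (𝓞 K), hf Q⟩
  have : Finite {q : Ideal (𝓞 K) // Ideal.absNorm q = p} :=
    Ideal.finite_setOfPred_absNorm_eq p
  have : Finite {q : Ideal (𝓞 N) // Ideal.absNorm q = p} :=
    Ideal.finite_setOfPred_absNorm_eq p
  cases nonempty_fintype {q : Ideal (𝓞 K) // Ideal.absNorm q = p}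
  rw [finsum_eq_sum_of_fintype, numId, ← Nat.card_congr (Equiv.sigmaFiberEquiv f), Nat.card_sigma]
  refine Finset.sum_congr rfl fun q _ => Nat.card_congr ?_
  refine ⟨fun Q => ⟨Q.1.1, Q.1.2, congrArg Subtype.val Q.2⟩,
    fun Q => ⟨⟨Q.1, Q.2.1⟩, Subtype.ext Q.2.2⟩, fun _ => rfl, fun _ => rfl⟩

lemma exists_good_set (N : Type*) [Field N] [NumberField N] [Algebra K N] [IsGalois K N] :
    ∃ B : Set Nat.Primes, B.Finite ∧ ∀ p : Nat.Primes, p ∉ B → 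
    (∀ τ : N ≃ₐ[K] N, τ ≠ 1 → ∃ x : 𝓞 N, ∀ Q : Ideal (𝓞 N), Q ≠ ⊤ → ((p : ℕ) : 𝓞 N) ∈ Q →
      τ • x - x ∉ Q) := by
  choose! x hx using fun τ : N ≃ₐ[K] N => exists_moved (K := K) τ
  refine ⟨⋃ τ ∈ {τ : N ≃ₐ[K] N | τ ≠ 1}, {p : Nat.Primes | ∃ Q : Ideal (𝓞 N), Q ≠ ⊤ ∧
    ((p : ℕ) : 𝓞 N) ∈ Q ∧ τ • x τ - x τ ∈ Q}, ?_, ?_⟩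
  · exact Set.Finite.biUnion (Set.toFinite _) fun τ hτ => bad_primes_finite _ (hx τ hτ)
  · intro p hp τ hτ
    refine ⟨x τ, fun Q hQ hpQ hc => hp ?_⟩
    simp only [Set.mem_iUnion]
    exact ⟨τ, hτ, Q, hQ, hpQ, hc⟩
end B3

open Polynomial NumberField IntermediateField
section B4
open scoped Pointwise

lemma pow_mem_zpowers_pow_iff {G : Type*} [Group G] (σ : G) {d k : ℕ} (hd : d ∣ orderOf σ) :
    σ ^ k ∈ Subgroup.zpowers (σ ^ d) ↔ d ∣ k := by
  constructor
  · rintro ⟨j, hj⟩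
    have h1 : σ ^ ((d : ℤ) * j) = σ ^ (k : ℤ) := by
      rw [zpow_mul]; simpa using hj
    have h2 := orderOf_dvd_sub_iff_zpow_eq_zpow.2 h1
    have h3 : (d : ℤ) ∣ (d : ℤ) * j - k := (Int.natCast_dvd_natCast.2 hd).trans h2
    have h4 : (d : ℤ) ∣ k := by
      have := dvd_sub (dvd_mul_right (d : ℤ) j) h3
      simpa using this
    exact Int.natCast_dvd_natCast.1 h4
  · rintro ⟨c, rfl⟩
    rw [pow_mul]
    exact Subgroup.pow_mem _ (Subgroup.mem_zpowers _) _

variable {K : Type*} [Field K] [NumberField K]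
variable {L : Type*} [Field L] [NumberField L] [Algebra K L] [IsGalois K L]

lemma exists_frob_over {p : ℕ} (hp : p.Prime) (q : Ideal (𝓞 K)) (hq : Ideal.absNorm q = p) :
    ∃ P : Ideal (𝓞 L), P.IsPrime ∧ P.under (𝓞 K) = q ∧ (p : 𝓞 L) ∈ P ∧
      ∃ φ : L ≃ₐ[K] L, ∀ x : 𝓞 L, φ • x - x ^ p ∈ P := by
  have hqp : q.IsPrime := Ideal.isPrime_of_irreducible_absNorm (by rw [hq]; exact hp)
  obtain ⟨P, -, hP, hPq⟩ := Ideal.exists_ideal_over_prime_of_isIntegral (S := 𝓞 L) q ⊥ (by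
    rw [← RingHom.ker_eq_comap_bot, (RingHom.injective_iff_ker_eq_bot _).1
      (FaithfulSMul.algebraMap_injective (𝓞 K) (𝓞 L))]
    exact bot_le)
  have hPq' : P.under (𝓞 K) = q := hPq
  have hpq := ((norm_prime_iff hp q).1 hq).1
  have hpP : (p : 𝓞 L) ∈ P := by
    rw [← hPq', Ideal.mem_under, map_natCast] at hpq
    exact hpq
  have hP0 : P ≠ ⊥ := by
    rintro rfl
    have : (p : 𝓞 L) = 0 := by simpa using hpP
    exact hp.ne_zero (by exact_mod_cast this)
  have := Ideal.finiteQuotientOfFreeOfNeBot P hP0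
  obtain ⟨φ, hφ⟩ := IsArithFrobAt.exists_of_isInvariant (𝓞 K) (L ≃ₐ[K] L) P
  refine ⟨P, hP, hPq', hpP, φ, fun x => ?_⟩
  have h1 := hφ x
  have h2 : Nat.card (𝓞 K ⧸ P.under (𝓞 K)) = p := by
    rw [hPq']; exact hq
  rw [h2] at h1
  exact h1

theorem exists_frob (σ : L ≃ₐ[K] L) (hσ : ∀ τ : L ≃ₐ[K] L, τ ∈ Subgroup.zpowers σ)
    (S : Set (𝓞 L)) (hS : S.Finite) (hS0 : ∀ x ∈ S, x ≠ 0) :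
    ∃ (p : ℕ) (P : Ideal (𝓞 L)) (φ : L ≃ₐ[K] L), p.Prime ∧ P.IsPrime ∧ (p : 𝓞 L) ∈ P ∧
      (∀ x ∈ S, x ∉ P) ∧ Ideal.absNorm (P.under (𝓞 K)) = p ∧ (∀ x : 𝓞 L, φ • x - x ^ p ∈ P) ∧
      ∀ τ : L ≃ₐ[K] L, τ ∈ Subgroup.zpowers φ := by
  classical
  have hcyc : IsCyclic (L ≃ₐ[K] L) := ⟨σ, hσ⟩
  have hcomm : ∀ a b : L ≃ₐ[K] L, a * b = b * a := fun a b => by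
    let _ := IsCyclic.commGroup (α := L ≃ₐ[K] L)
    exact mul_comm a b
  set m := orderOf σ with hm
  have hmpos : 0 < m := orderOf_pos σ
  have hmcard : m = Nat.card (L ≃ₐ[K] L) := orderOf_eq_card_of_forall_mem_zpowers hσ
  let ι := {d : ℕ // d ∈ m.divisors}
  have hnorm : ∀ d : ℕ, (Subgroup.zpowers (σ ^ d)).Normal := fun d =>
    ⟨fun a ha g => by rwa [hcomm g a, mul_inv_cancel_right]⟩
  let N : ι → IntermediateField K L := fun d => fixedField (Subgroup.zpowers (σ ^ (d : ℕ)))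
  have hGal : ∀ d, IsGalois K (N d) := fun d => by
    have := hnorm d
    exact IsGalois.of_fixedField_normal_subgroup _
  have hdeg : ∀ d, Module.finrank K (N d) = d := by
    intro d
    have hd := (Nat.mem_divisors.1 d.2).1
    have h1 := Module.finrank_mul_finrank K (N d) L
    have h2 : Module.finrank (N d) L = m / d := by
      rw [finrank_fixedField_eq_card, Nat.card_zpowers, orderOf_pow' σ (Nat.pos_of_dvd_of_pos hd hmpos).ne']
      rw [Nat.gcd_eq_right hd]
    rw [h2, ← IsGalois.card_aut_eq_finrank K L, ← hmcard] at h1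
    have h3 : (d : ℕ) * (m / d) = m := Nat.mul_div_cancel' hd
    have hcpos : 0 < m / (d : ℕ) := Nat.div_pos (Nat.le_of_dvd hmpos hd) (Nat.pos_of_mem_divisors d.2)
    exact Nat.eq_of_mul_eq_mul_right hcpos (h1.trans h3.symm)
  have hfix : ∀ d, (N d).fixingSubgroup = Subgroup.zpowers (σ ^ (d : ℕ)) := fun d =>
    fixingSubgroup_fixedField _
  choose B hB hBgood using fun d => (have := hGal d; exists_good_set (K := K) (N d))
  let BS : Set Nat.Primes := ⋃ x ∈ S, {p : Nat.Primes | ∃ Q : Ideal (𝓞 L), Q ≠ ⊤ ∧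
    ((p : ℕ) : 𝓞 L) ∈ Q ∧ x ∈ Q}
  have hBS : BS.Finite := Set.Finite.biUnion hS fun x hx => bad_primes_finite x (hS0 x hx)
  obtain ⟨p, hpB, hpos⟩ := exists_prime_comb (fun d : ι => N d)
    (fun d => (ArithmeticFunction.moebius (d : ℕ) : ℝ) / (d : ℕ)) (by
      rw [finsum_eq_sum_of_fintype]
      rw [Finset.sum_coe_sort m.divisors (fun d => (ArithmeticFunction.moebius d : ℝ) / d)]
      exact moebius_div_pos m hmpos) ((⋃ d, B d) ∪ BS)
      ((Set.finite_iUnion hB).union hBS)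
  have hp : (p : ℕ).Prime := p.2
  let Q := {q : Ideal (𝓞 K) // Ideal.absNorm q = (p : ℕ)}
  choose P hPp hPq hpP φ hφ using fun q : Q => exists_frob_over (L := L) hp q.1 q.2
  have : Finite Q := Ideal.finite_setOfPred_absNorm_eq (p : ℕ)
  cases nonempty_fintype Q
  have hnum : ∀ d, (numId (N d) p : ℝ) = ∑ q : Q,
      if φ q ∈ Subgroup.zpowers (σ ^ (d : ℕ)) then ((d : ℕ) : ℝ) else 0 := by
    intro d
    have := hGal d
    rw [numId_fiber (K := K) hp, finsum_eq_sum_of_fintype, Nat.cast_sum]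
    refine Finset.sum_congr rfl fun q _ => ?_
    have := hPp q
    rw [card_fiber_eq hp q.1 (P q) (hPq q) (hpP q) (φ q) (hφ q) (N d)
      (hBgood d p (fun h => hpB (Or.inl (Set.mem_iUnion.2 ⟨d, h⟩)))), hfix, hdeg]
    split_ifs <;> simp
  rw [finsum_eq_sum_of_fintype] at hpos
  simp_rw [hnum, Finset.mul_sum] at hpos
  rw [Finset.sum_comm] at hpos
  obtain ⟨q, -, hq⟩ := Finset.exists_lt_of_sum_lt (s := Finset.univ) (f := fun _ : Q => (0 : ℝ))
    (by simpa using hpos)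
  obtain ⟨k, hk⟩ : ∃ k : ℕ, σ ^ k = φ q := by
    have := hσ (φ q)
    rw [mem_zpowers_iff_mem_range_orderOf] at this
    obtain ⟨k, -, hk⟩ := Finset.mem_image.1 this
    exact ⟨k, hk⟩
  have hcop : m.Coprime k := by
    apply moebius_sum_coprime m k hmpos
    refine lt_of_lt_of_eq hq ?_
    rw [← Finset.sum_coe_sort m.divisors (fun d => (ArithmeticFunction.moebius d : ℝ) *
      (if d ∣ k then 1 else 0))]
    refine Finset.sum_congr rfl fun d _ => ?_
    rw [← hk]
    have hd0 : ((d : ℕ) : ℝ) ≠ 0 := by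
      exact_mod_cast (Nat.pos_of_mem_divisors d.2).ne'
    simp only [pow_mem_zpowers_pow_iff σ (Nat.mem_divisors.1 d.2).1]
    split_ifs
    · field_simp
    · simp
  refine ⟨p, P q, φ q, hp, hPp q, hpP q, ?_, by rw [hPq q]; exact q.2, hφ q, ?_⟩
  · intro x hx hxP
    apply hpB
    right
    simp only [BS, Set.mem_iUnion]
    exact ⟨x, hx, P q, (hPp q).ne_top, hpP q, hxP⟩
  · have hs : σ ∈ Subgroup.zpowers (φ q) := by
      rw [← hk, mem_zpowers_pow_iff]
      exact hcop.symm
    intro τ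
    exact (Subgroup.zpowers_le.2 hs) (hσ τ)
end B4

open Polynomial NumberField IntermediateField
section C1

lemma exists_good_prime_aux {F L : Type*} [Field F] [NumberField F] [Field L] [NumberField L]
    [Algebra F L] [IsGalois F L] (p : (𝓞 F)[X]) (hp0 : p ≠ 0)
    (hspl : (p.map (algebraMap (𝓞 F) L)).Splits) (σ : L ≃ₐ[F] L)
    (hσ : ∀ t : L, aeval t p = 0 → σ t ≠ t) :
    ∃ P : Ideal (𝓞 F), P.IsPrime ∧ P ≠ ⊥ ∧ p.leadingCoeff ∉ P ∧ ∀ a : 𝓞 F, p.eval a ∉ P := by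
  classical
  set c := p.leadingCoeff with hc
  have hc0 : c ≠ 0 := leadingCoeff_ne_zero.2 hp0
  have hcL : algebraMap (𝓞 F) (𝓞 L) c ≠ 0 := by
    rw [Ne, FaithfulSMul.algebraMap_eq_zero_iff]; exact hc0
  have hcL' : algebraMap (𝓞 F) L c ≠ 0 := by
    rw [Ne, FaithfulSMul.algebraMap_eq_zero_iff]; exact hc0
  set s := (p.map (algebraMap (𝓞 F) L)).roots with hs
  have hroot : ∀ θ ∈ s, aeval θ p = 0 := by
    intro θ hθ
    have := isRoot_of_mem_roots hθ
    rwa [IsRoot.def, eval_map_algebraMap] at this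
  have hintg : ∀ θ : L, ∃ β : 𝓞 L, θ ∈ s → algebraMap (𝓞 L) L β = algebraMap (𝓞 F) L c * θ := by
    intro θ
    by_cases h : θ ∈ s
    · have h1 : IsIntegral (𝓞 F) (c • θ) := isIntegral_leadingCoeff_smul p θ (hroot θ h)
      have h2 : IsIntegral ℤ (c • θ) := isIntegral_trans (R := ℤ) (A := 𝓞 F) _ h1
      exact ⟨⟨c • θ, h2⟩, fun _ => by rw [← Algebra.smul_def]; rfl⟩
    · exact ⟨0, fun h' => absurd h' h⟩
  choose g hg using hintg
  let K : IntermediateField F L := fixedField (Subgroup.zpowers σ)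
  have hfix : K.fixingSubgroup = Subgroup.zpowers σ := fixingSubgroup_fixedField _
  have hσK : σ ∈ K.fixingSubgroup := by rw [hfix]; exact Subgroup.mem_zpowers σ
  let e := fixingSubgroupEquiv K
  let σ' : L ≃ₐ[K] L := e ⟨σ, hσK⟩
  have hσ'gen : ∀ τ : L ≃ₐ[K] L, τ ∈ Subgroup.zpowers σ' := by
    intro τ
    have h1 : ((e.symm τ : K.fixingSubgroup) : L ≃ₐ[F] L) ∈ Subgroup.zpowers σ := by
      rw [← hfix]; exact (e.symm τ).2
    obtain ⟨k, hk⟩ := h1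
    refine ⟨k, ?_⟩
    simp only [σ'] at hk ⊢
    rw [← map_zpow, ← e.apply_symm_apply τ]
    congr 1
    exact Subtype.ext hk
  let S : Set (𝓞 L) := {algebraMap (𝓞 F) (𝓞 L) c} ∪
    ((fun x : (L ≃ₐ[K] L) × L => x.1 • g x.2 - g x.2) '' (Set.univ ×ˢ (s.toFinset : Set L)) \ {0})
  have hS : S.Finite := by
    refine (Set.finite_singleton _).union (Set.Finite.sdiff (Set.Finite.image _ ?_))
    exact Set.finite_univ.prod (Finset.finite_toSet _)
  have hS0 : ∀ x ∈ S, x ≠ 0 := by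
    rintro x (hx | hx)
    · rw [Set.mem_singleton_iff.1 hx]; exact hcL
    · exact hx.2
  obtain ⟨r, P, φ, hr, hP, hrP, hSP, -, hφ, hgen⟩ := exists_frob σ' hσ'gen S hS hS0
  have hcP : algebraMap (𝓞 F) (𝓞 L) c ∉ P := hSP _ (Or.inl rfl)
  refine ⟨P.under (𝓞 F), inferInstance, ?_, ?_, ?_⟩
  · intro hb
    have : (r : 𝓞 F) ∈ P.under (𝓞 F) := by rw [Ideal.mem_under, map_natCast]; exact hrP
    rw [hb] at this
    have : (r : 𝓞 F) = 0 := by simpa using this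
    exact hr.ne_zero (by exact_mod_cast this)
  · rw [Ideal.mem_under]; exact hcP
  · intro a ha
    rw [Ideal.mem_under] at ha
    set ca := algebraMap (𝓞 F) (𝓞 L) (c * a) with hca
    have hprod : algebraMap (𝓞 F) (𝓞 L) c ^ (Multiset.card s) * algebraMap (𝓞 F) (𝓞 L) (p.eval a) =
        algebraMap (𝓞 F) (𝓞 L) c * (s.map (fun θ => ca - g θ)).prod := by
      apply FaithfulSMul.algebraMap_injective (𝓞 L) L
      have hev : algebraMap (𝓞 F) L (p.eval a) = algebraMap (𝓞 F) L c *
          (s.map (fun θ => algebraMap (𝓞 F) L a - θ)).prod := by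
        have h1 := hspl.eval_eq_prod_roots (algebraMap (𝓞 F) L a)
        rw [eval_map_algebraMap, aeval_algebraMap_apply, leadingCoeff_map_of_injective
          (FaithfulSMul.algebraMap_injective (𝓞 F) L)] at h1
        simpa using h1
      have h2 : ∀ x : 𝓞 F, algebraMap (𝓞 L) L (algebraMap (𝓞 F) (𝓞 L) x) = algebraMap (𝓞 F) L x :=
        fun x => rfl
      have h3 : algebraMap (𝓞 L) L ((s.map (fun θ => ca - g θ)).prod) =
          (s.map (fun θ => algebraMap (𝓞 F) L c * (algebraMap (𝓞 F) L a - θ))).prod := by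
        rw [map_multiset_prod, Multiset.map_map]
        congr 1
        refine Multiset.map_congr rfl fun θ hθ => ?_
        simp only [Function.comp, map_sub, hca]
        rw [hg θ hθ, h2, map_mul]
        ring
      rw [map_mul, map_mul, map_pow, h3, h2, h2, hev, Multiset.prod_map_mul]
      simp
      ring
    have hmem : (s.map (fun θ => ca - g θ)).prod ∈ P := by
      have : algebraMap (𝓞 F) (𝓞 L) c * (s.map (fun θ => ca - g θ)).prod ∈ P := by
        rw [← hprod]; exact P.mul_mem_left _ ha
      exact (hP.mem_or_mem this).resolve_left hcP
    rw [Ideal.IsPrime.multiset_prod_mem_iff_exists_mem hP] at hmem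
    obtain ⟨y, hy, hyP⟩ := hmem
    obtain ⟨θ, hθ, rfl⟩ := Multiset.mem_map.1 hy
    have hfa : φ • ca = ca := by
      apply RingOfIntegers.ext
      have : (φ.restrictScalars F) (algebraMap F L (c * a : 𝓞 F)) = algebraMap F L (c * a : 𝓞 F) :=
        AlgEquiv.commutes _ _
      exact this
    have h1 : ca - ca ^ r ∈ P := by
      have := hφ ca
      rwa [hfa] at this
    have h2 : ca ^ r - g θ ^ r ∈ P := P.mem_of_dvd (sub_dvd_pow_sub_pow _ _ r) hyP
    have h3 : φ • g θ - g θ ∈ P := by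
      have : φ • g θ - g θ = (φ • g θ - g θ ^ r) - (ca ^ r - g θ ^ r) - (ca - ca ^ r) + (ca - g θ) := by
        ring
      rw [this]
      exact P.add_mem (P.sub_mem (P.sub_mem (hφ _) h2) h1) hyP
    have h4 : φ • g θ - g θ = 0 := by
      by_contra hne
      exact hSP _ (Or.inr ⟨⟨(φ, θ), ⟨trivial, by simpa using hθ⟩, rfl⟩, hne⟩) h3
    have h5 : φ (algebraMap (𝓞 L) L (g θ)) = algebraMap (𝓞 L) L (g θ) := congrArg (algebraMap (𝓞 L) L) (sub_eq_zero.1 h4)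
    have h6 : φ θ = θ := by
      rw [hg θ hθ, map_mul] at h5
      have : φ (algebraMap (𝓞 F) L c) = algebraMap (𝓞 F) L c :=
        AlgEquiv.commutes (φ.restrictScalars F) (c : F)
      rw [this] at h5
      exact mul_left_cancel₀ hcL' h5
    have h7 : φ ∈ MulAction.stabilizer (L ≃ₐ[K] L) θ := h6
    have h8 : σ' ∈ MulAction.stabilizer (L ≃ₐ[K] L) θ := (Subgroup.zpowers_le.2 h7) (hgen σ')
    exact hσ θ (hroot θ hθ) h8
end C1

open Polynomial NumberField IntermediateField
section D1

lemma irreducible_X_pow_sub_C_of_prime {R K : Type*} [CommRing R] [IsDomain R]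
    [IsIntegrallyClosed R] [Field K] [Algebra R K] [IsFractionRing R K] (P : Ideal R) (hP : P.IsPrime)
    (d : R) (hd : d ∈ P) (hd2 : d ∉ P ^ 2) (n : ℕ) (hn : n ≠ 0) :
    Irreducible (X ^ n - C (algebraMap R K d)) := by
  have hmon : (X ^ n - C d : R[X]).Monic := monic_X_pow_sub_C d hn
  have h1 : Irreducible (X ^ n - C d : R[X]) := by
    refine IsEisensteinAt.irreducible (𝓟 := P) ⟨?_, ?_, ?_⟩ hP hmon.isPrimitive ?_
    · rw [hmon.leadingCoeff]
      exact fun h => hP.ne_top ((Ideal.eq_top_iff_one P).2 h)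
    · intro k hk
      rw [natDegree_X_pow_sub_C] at hk
      rw [coeff_sub, coeff_X_pow, if_neg hk.ne, coeff_C, zero_sub]
      split_ifs
      · exact P.neg_mem hd
      · simp
    · rw [coeff_sub, coeff_X_pow, if_neg hn.symm, coeff_C_zero, zero_sub, neg_mem_iff]
      exact hd2
    · rw [natDegree_X_pow_sub_C]; omega
  have h2 := (hmon.irreducible_iff_irreducible_map_fraction_map (K := K)).1 h1
  simpa using h2

lemma root_ratio {F M : Type*} [Field F] [Field M] [Algebra F M] {n : ℕ} {ζ : F}
    (hζ : IsPrimitiveRoot ζ n) (hn : 0 < n) {c : F} {x y : M} (hx0 : x ≠ 0)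
    (hx : x ^ n = algebraMap F M c) (hy : y ^ n = algebraMap F M c) :
    ∃ i : ℕ, y = algebraMap F M (ζ ^ i) * x := by
  have : (y / x) ^ n = 1 := by
    rw [div_pow, hx, hy, div_self]
    rw [← hx]; exact pow_ne_zero _ hx0
  have hζM : IsPrimitiveRoot (algebraMap F M ζ) n := hζ.map_of_injective (algebraMap F M).injective
  have : NeZero n := ⟨hn.ne'⟩
  obtain ⟨i, -, hi⟩ := hζM.eq_pow_of_pow_eq_one ‹(y / x) ^ n = 1›
  exact ⟨i, by rw [map_pow, hi, div_mul_cancel₀ _ hx0]⟩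

lemma kummer_rel {F M : Type*} [Field F] [Field M] [Algebra F M] {n m : ℕ} (hn : 0 < n)
    (hm : 0 < m) (hmn : m ∣ n) {ζ : F} (hζ : IsPrimitiveRoot ζ n) (d c : F) (hc : c ≠ 0)
    (hirr : Irreducible (X ^ m - C d))
    (h1 : IsSplittingField F M (X ^ m - C d)) (h2 : IsSplittingField F M (X ^ n - C c)) :
    ∃ (b : F) (j : ℕ), d ^ n = b ^ (m * n) * c ^ (j * m) := by
  have hζm : IsPrimitiveRoot (ζ ^ (n / m)) m := hζ.pow hn (Nat.div_mul_cancel hmn).symm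
  have hne : (primitiveRoots m F).Nonempty := ⟨_, (mem_primitiveRoots hm).2 hζm⟩
  have : NeZero m := ⟨hm.ne'⟩
  have hfd : FiniteDimensional F M := IsSplittingField.finiteDimensional M (X ^ m - C d)
  have hgal : IsGalois F M := isGalois_of_isSplittingField_X_pow_sub_C hne hirr M
  have hcyc : IsCyclic (M ≃ₐ[F] M) := isCyclic_of_isSplittingField_X_pow_sub_C hne hirr M
  have hcard : Nat.card (M ≃ₐ[F] M) = m := by
    rw [IsGalois.card_aut_eq_finrank, finrank_of_isSplittingField_X_pow_sub_C hne hirr M]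
  obtain ⟨σ, hσ⟩ := hcyc
  have hord : orderOf σ = m := by rw [orderOf_eq_card_of_forall_mem_zpowers hσ, hcard]
  obtain ⟨β, hβ⟩ : ∃ β : M, β ^ m = algebraMap F M d := by
    have hs := h1.splits'
    obtain ⟨x, hx⟩ := hs.exists_eval_eq_zero (by
      rw [degree_map, degree_X_pow_sub_C hm]; exact_mod_cast hm.ne')
    refine ⟨x, ?_⟩
    simpa [sub_eq_zero] using hx
  obtain ⟨γ, hγ⟩ : ∃ γ : M, γ ^ n = algebraMap F M c := by
    have hs := h2.splits'
    obtain ⟨x, hx⟩ := hs.exists_eval_eq_zero (by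
      rw [degree_map, degree_X_pow_sub_C hn]; exact_mod_cast hn.ne')
    refine ⟨x, ?_⟩
    simpa [sub_eq_zero] using hx
  have hγ0 : γ ≠ 0 := by
    rintro rfl
    rw [zero_pow hn.ne'] at hγ
    exact hc ((FaithfulSMul.algebraMap_eq_zero_iff F M).1 hγ.symm)
  by_cases hβ0 : β = 0
  · rw [hβ0, zero_pow hm.ne'] at hβ
    have hd0 : d = 0 := (FaithfulSMul.algebraMap_eq_zero_iff F M).1 hβ.symm
    exact ⟨0, 0, by rw [hd0, zero_pow hn.ne', zero_pow (Nat.mul_pos hm hn).ne', zero_mul]⟩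
  obtain ⟨i₁, hi₁⟩ := root_ratio hζm hm hβ0 hβ (y := σ β) (by rw [← map_pow, hβ, AlgEquiv.commutes])
  obtain ⟨i₂, hi₂⟩ := root_ratio hζ hn hγ0 hγ (y := σ γ) (by rw [← map_pow, hγ, AlgEquiv.commutes])
  set ζ₁ := (ζ ^ (n / m)) ^ i₁ with hζ₁
  set ζ₂ := ζ ^ i₂ with hζ₂
  have hpow : ∀ k : ℕ, (σ ^ k) γ = algebraMap F M (ζ₂ ^ k) * γ := by
    intro k
    induction k with
    | zero => simp
    | succ k ih =>
      rw [pow_succ', AlgEquiv.mul_apply, ih, map_mul, AlgEquiv.commutes, hi₂, pow_succ, map_mul]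
      ring
  have hprim : IsPrimitiveRoot ζ₂ m := by
    constructor
    · have := hpow m
      rw [← hord, pow_orderOf_eq_one, AlgEquiv.one_apply, hord] at this
      have h3 : algebraMap F M (ζ₂ ^ m) = 1 := by
        have h4 : 1 * γ = algebraMap F M (ζ₂ ^ m) * γ := by rw [one_mul]; exact this
        exact (mul_right_cancel₀ hγ0 h4).symm
      exact (algebraMap F M).injective (by rw [h3, map_one])
    · intro k hk
      rw [← hord]
      apply orderOf_dvd_of_pow_eq_one
      have hfix : (σ ^ k) γ = γ := by rw [hpow, hk, map_one, one_mul]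
      have hext : ((σ ^ k : M ≃ₐ[F] M) : M →ₐ[F] M) = AlgHom.id F M := by
        refine AlgHom.ext_of_adjoin_eq_top h2.adjoin_rootSet' ?_
        intro y hy
        have hy' : y ^ n = algebraMap F M c := by
          have := (mem_rootSet.1 hy).2
          simpa [sub_eq_zero] using this
        obtain ⟨i, rfl⟩ := root_ratio hζ hn hγ0 hγ hy'
        rw [map_mul, AlgHom.commutes]
        change _ * (σ ^ k) γ = _
        rw [hfix]; rfl
      ext y
      exact DFunLike.congr_fun hext y
  obtain ⟨j, -, hj⟩ := hprim.eq_pow_of_pow_eq_one (ξ := ζ₁) (by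
    rw [hζ₁, ← pow_mul, mul_comm, pow_mul, hζm.pow_eq_one, one_pow])
  have hinv : ∀ τ : M ≃ₐ[F] M, τ (β / γ ^ j) = β / γ ^ j := by
    have h3 : σ ∈ MulAction.stabilizer (M ≃ₐ[F] M) (β / γ ^ j) := by
      change σ (β / γ ^ j) = β / γ ^ j
      rw [map_div₀, map_pow, hi₁, hi₂, mul_pow, ← map_pow, hj]
      have : algebraMap F M ζ₁ ≠ 0 := by
        rw [Ne, FaithfulSMul.algebraMap_eq_zero_iff, hζ₁]
        exact pow_ne_zero _ (hζm.ne_zero hm.ne')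
      field_simp
    intro τ
    exact (Subgroup.zpowers_le.2 h3) (hσ τ)
  obtain ⟨b, hb⟩ := (IsGalois.mem_range_algebraMap_iff_fixed (F := F) _).2 hinv
  refine ⟨b, j, (algebraMap F M).injective ?_⟩
  have hβeq : β = algebraMap F M b * γ ^ j := by
    rw [hb, div_mul_cancel₀ _ (pow_ne_zero _ hγ0)]
  rw [map_pow, ← hβ, hβeq, map_mul, map_pow, map_pow, ← hγ]
  ring
end D1

open Polynomial NumberField IntermediateField
section D2
open IsDedekindDomain

variable {R K : Type*} [CommRing R] [IsDedekindDomain R] [Field K] [Algebra R K]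
  [IsFractionRing R K]

lemma val_aeval_eq_one (v : HeightOneSpectrum R) (q : R[X]) (a : R) (t : K)
    (h : v.valuation K (t - algebraMap R K a) < 1) (hq : q.eval a ∉ v.asIdeal) :
    v.valuation K (aeval t q) = 1 := by
  have hle : ∀ x : R, v.valuation K (algebraMap R K x) ≤ 1 := fun x => v.valuation_le_one x
  let O := (v.valuation K).valuationSubring
  let i : R →+* O := (algebraMap R K).codRestrict O.toSubring (fun x => hle x)
  have ht : v.valuation K t ≤ 1 := by
    have : t = (t - algebraMap R K a) + algebraMap R K a := by ring
    rw [this]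
    exact (Valuation.map_add _ _ _).trans (max_le h.le (hle a))
  let t' : O := ⟨t, ht⟩
  obtain ⟨z, hz⟩ := sub_dvd_eval_sub t' (i a) (q.map i)
  have hi : (O.subtype).comp i = algebraMap R K := rfl
  have h1 : ∀ y : O, O.subtype ((q.map i).eval y) = aeval (y : K) q := by
    intro y
    rw [eval_map, hom_eval₂, hi]
    rfl
  have h2 := congrArg O.subtype hz
  rw [map_sub, map_mul, h1, h1, map_sub] at h2
  have h3 : aeval ((i a : O) : K) q = algebraMap R K (q.eval a) := aeval_algebraMap_apply K a q
  rw [h3] at h2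
  have hlt : v.valuation K (aeval t q - algebraMap R K (q.eval a)) < 1 := by
    have : aeval t q - algebraMap R K (q.eval a) = (t - algebraMap R K a) * (z : K) := h2
    rw [this, map_mul]
    have hz1 : v.valuation K (z : K) ≤ 1 := z.2
    exact (mul_le_of_le_one_right' hz1).trans_lt h
  have hone : v.valuation K (algebraMap R K (q.eval a)) = 1 :=
    (v.valuation_eq_one_iff_notMem).2 hq
  have : aeval t q = (aeval t q - algebraMap R K (q.eval a)) + algebraMap R K (q.eval a) := by ring
  rw [this, Valuation.map_add_eq_of_lt_right _ (by rw [hone]; exact hlt), hone]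

lemma val_aeval_pow (v : HeightOneSpectrum R) (q : R[X]) (hlc : q.leadingCoeff ∉ v.asIdeal)
    (hq : ∀ a, q.eval a ∉ v.asIdeal) (t : K) (n : ℕ) (hn : n ∣ q.natDegree) :
    ∃ u : K, u ≠ 0 ∧ v.valuation K (aeval t q) = v.valuation K u ^ n := by
  by_cases ht : v.valuation K t ≤ 1
  · obtain ⟨a, ha⟩ := v.exists_valuation_sub_lt_of_integer ht 1
    refine ⟨1, one_ne_zero, ?_⟩
    rw [map_one, one_pow]
    refine val_aeval_eq_one v q a t ?_ (hq a)
    rw [← Valuation.map_neg, neg_sub]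
    simpa using ha
  · push Not at ht
    have ht0 : t ≠ 0 := by rintro rfl; simp at ht
    obtain ⟨k, hk⟩ := hn
    refine ⟨t ^ k, pow_ne_zero _ ht0, ?_⟩
    have h1 : v.valuation K (aeval t⁻¹ q.reverse) = 1 := by
      refine val_aeval_eq_one v q.reverse 0 t⁻¹ ?_ ?_
      · rw [map_zero, sub_zero, map_inv₀]
        exact inv_lt_one_of_one_lt₀ ht
      · rw [← coeff_zero_eq_eval_zero, coeff_zero_reverse]; exact hlc
    let _ : Invertible t := invertibleOfNonzero ht0
    have h2 := eval₂_reverse_mul_pow (algebraMap R K) t q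
    rw [invOf_eq_inv] at h2
    change aeval t⁻¹ q.reverse * t ^ q.natDegree = aeval t q at h2
    rw [← h2, map_mul, h1, one_mul, map_pow, map_pow, hk, ← pow_mul, mul_comm]

lemma val_contra (v : HeightOneSpectrum R) {n m : ℕ} (hn : 0 < n) (hm : 2 ≤ m) (d b c u : K)
    (hd : v.valuation K d = WithZero.exp (-1 : ℤ)) (hu : u ≠ 0)
    (hc : v.valuation K c = v.valuation K u ^ n) (j : ℕ)
    (h : d ^ n = b ^ (m * n) * c ^ (j * m)) : False := by
  have h1 := congrArg (v.valuation K) h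
  rw [map_pow, map_mul, map_pow, map_pow, hc, hd] at h1
  have h2 : v.valuation K b ^ (m * n) * (v.valuation K u ^ n) ^ (j * m) =
      v.valuation K (b * u ^ j) ^ (m * n) := by
    rw [map_mul, map_pow, mul_pow, ← pow_mul, ← pow_mul]; congr 2; ring
  rw [h2] at h1
  have hne : v.valuation K (b * u ^ j) ≠ 0 := by
    intro h0
    rw [h0, zero_pow (Nat.mul_pos (by omega) hn).ne', ← WithZero.exp_nsmul] at h1
    exact WithZero.exp_ne_zero h1
  obtain ⟨k, hk⟩ : ∃ k : ℤ, v.valuation K (b * u ^ j) = WithZero.exp k :=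
    ⟨_, (WithZero.exp_log hne).symm⟩
  rw [hk, ← WithZero.exp_nsmul, ← WithZero.exp_nsmul, WithZero.exp_inj] at h1
  simp only [nsmul_eq_mul] at h1
  push_cast at h1
  have hn' : (n : ℤ) ≠ 0 := by exact_mod_cast hn.ne'
  have h3 : (-1 : ℤ) = m * k := by
    apply mul_left_cancel₀ hn'
    rw [h1]; ring
  have h4 : (m : ℤ) ∣ 1 := ⟨-k, by linarith⟩
  have := Int.le_of_dvd one_pos h4
  omega

end D2

section D3
open IsDedekindDomain

theorem nonspec (F : Type*) [Field F] [NumberField F] (n : ℕ) (hn : 2 ≤ n)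
    (ζ : F) (hζ : IsPrimitiveRoot ζ n)
    (p : Polynomial (𝓞 F)) (hp0 : p ≠ 0) (hnN : n ∣ p.natDegree)
    (hsep : (p.map (algebraMap (𝓞 F) F)).Separable)
    (hGal : ∃ σ : (p.map (algebraMap (𝓞 F) F)).SplittingField ≃ₐ[F]
        (p.map (algebraMap (𝓞 F) F)).SplittingField,
      ∀ t : (p.map (algebraMap (𝓞 F) F)).SplittingField,
        aeval t (p.map (algebraMap (𝓞 F) F)) = 0 → σ t ≠ t) :
    (∀ n'' : ℕ, 2 ≤ n'' → n'' ∣ n →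
      ∃ M : IntermediateField F (AlgebraicClosure F),
        IsGalois F M ∧ IsCyclic (M ≃ₐ[F] M) ∧ Nat.card (M ≃ₐ[F] M) = n'' ∧
        ¬ ((∃ t₀ : F, (p.map (algebraMap (𝓞 F) F)).eval t₀ ≠ 0 ∧
              M = IntermediateField.adjoin F
                (((X : F[X]) ^ n - C ((p.map (algebraMap (𝓞 F) F)).eval t₀)).rootSet
                  (AlgebraicClosure F))) ∨
            M = IntermediateField.adjoin F
              (((X : F[X]) ^ n - C ((p.map (algebraMap (𝓞 F) F)).leadingCoeff)).rootSet
                (AlgebraicClosure F)))) := by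
  intro m hm hmn
  have hlcm : (p.map (algebraMap (𝓞 F) F)).leadingCoeff = algebraMap (𝓞 F) F p.leadingCoeff :=
    leadingCoeff_map_of_injective (FaithfulSMul.algebraMap_injective (𝓞 F) F) p
  obtain ⟨P, hP, hP0, hlc, hev⟩ : ∃ P : Ideal (𝓞 F), P.IsPrime ∧ P ≠ ⊥ ∧ p.leadingCoeff ∉ P ∧
      ∀ a : 𝓞 F, p.eval a ∉ P := by
    obtain ⟨σ, hσ⟩ := hGal
    have : NumberField (p.map (algebraMap (𝓞 F) F)).SplittingField :=
      NumberField.of_module_finite F _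
    have : IsGalois F (p.map (algebraMap (𝓞 F) F)).SplittingField :=
      IsGalois.of_separable_splitting_field hsep
    refine exists_good_prime_aux (L := (p.map (algebraMap (𝓞 F) F)).SplittingField) p hp0 ?_ σ ?_
    · have := SplittingField.splits (p.map (algebraMap (𝓞 F) F))
      rwa [Polynomial.map_map, ← IsScalarTower.algebraMap_eq] at this
    · intro t ht
      apply hσ t
      rw [aeval_map_algebraMap]; exact ht
  let v : HeightOneSpectrum (𝓞 F) := ⟨P, hP, hP0⟩
  obtain ⟨d, hd⟩ := v.intValuation_exists_uniformizer
  have hdF : v.valuation F (algebraMap (𝓞 F) F d) = WithZero.exp (-1 : ℤ) := by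
    rw [HeightOneSpectrum.valuation_of_algebraMap]; exact hd
  have hirr : Irreducible (X ^ m - C (algebraMap (𝓞 F) F d)) := by
    apply irreducible_X_pow_sub_C_of_prime P hP d _ _ m (by omega)
    · rw [← pow_one P]
      exact (v.intValuation_le_pow_iff_mem d 1).1 (by rw [hd]; simp)
    · intro h
      have := (v.intValuation_le_pow_iff_mem d 2).2 h
      rw [hd, WithZero.exp_le_exp] at this
      norm_num at this
  have hζm : IsPrimitiveRoot (ζ ^ (n / m)) m := hζ.pow (by omega) (Nat.div_mul_cancel hmn).symm
  have hne : (primitiveRoots m F).Nonempty := ⟨_, (mem_primitiveRoots (by omega)).2 hζm⟩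
  have : NeZero m := ⟨by omega⟩
  let M : IntermediateField F (AlgebraicClosure F) := IntermediateField.adjoin F
    (((X : F[X]) ^ m - C (algebraMap (𝓞 F) F d)).rootSet (AlgebraicClosure F))
  have hspl : ∀ f : F[X], IsSplittingField F
      (IntermediateField.adjoin F (f.rootSet (AlgebraicClosure F))) f := fun f =>
    IntermediateField.adjoin_rootSet_isSplittingField (IsAlgClosed.splits _)
  have hM : IsSplittingField F M (X ^ m - C (algebraMap (𝓞 F) F d)) := hspl _
  have hfd : FiniteDimensional F M := IsSplittingField.finiteDimensional M
    (X ^ m - C (algebraMap (𝓞 F) F d))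
  have hgal : IsGalois F M := isGalois_of_isSplittingField_X_pow_sub_C hne hirr M
  have key : ∀ c : F, c ≠ 0 → (∃ u : F, u ≠ 0 ∧ v.valuation F c = v.valuation F u ^ n) →
      M ≠ IntermediateField.adjoin F (((X : F[X]) ^ n - C c).rootSet (AlgebraicClosure F)) := by
    rintro c hc ⟨u, hu, huc⟩ hMc
    have h2 : IsSplittingField F M (X ^ n - C c) := by
      rw [hMc]; exact hspl _
    obtain ⟨b, j, h⟩ := kummer_rel (by omega) (by omega) hmn hζ _ c hc hirr hM h2
    exact val_contra v (by omega) hm _ b c u hdF hu huc j h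
  refine ⟨M, hgal, isCyclic_of_isSplittingField_X_pow_sub_C hne hirr M, ?_, ?_⟩
  · rw [IsGalois.card_aut_eq_finrank, finrank_of_isSplittingField_X_pow_sub_C hne hirr M]
  · rintro (⟨t, ht, hMt⟩ | hMl)
    · refine key _ ht ?_ hMt
      have := val_aeval_pow (K := F) v p hlc hev t n hnN
      rwa [eval_map_algebraMap]
    · rw [hlcm] at hMl
      refine key _ ?_ ⟨1, one_ne_zero, ?_⟩ hMl
      · rw [Ne, FaithfulSMul.algebraMap_eq_zero_iff]; exact leadingCoeff_ne_zero.2 hp0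
      · rw [map_one, one_pow, HeightOneSpectrum.valuation_eq_one_iff_notMem]; exact hlc
end D3

open Polynomial NumberField IntermediateField
section E1
open IsDedekindDomain

lemma ratFunc_const {F : Type*} [Field F] (z : RatFunc F) (hz : IsAlgebraic F z) :
    ∃ a : F, algebraMap F (RatFunc F) a = z := by
  have h1 : IsIntegral F[X] z := (isAlgebraic_iff_isIntegral.1 hz).tower_top
  obtain ⟨g, rfl⟩ := IsIntegrallyClosed.isIntegral_iff.1 h1
  have h2 : IsAlgebraic F g :=
    (isAlgebraic_algebraMap_iff (IsFractionRing.injective F[X] (RatFunc F))).1 hz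
  obtain ⟨q, hq0, hq⟩ := h2
  rw [← comp_eq_aeval] at hq
  rcases comp_eq_zero_iff.1 hq with h | ⟨-, h⟩
  · exact absurd h hq0
  · refine ⟨g.coeff 0, ?_⟩
    rw [h, coeff_C_zero, IsScalarTower.algebraMap_apply F F[X] (RatFunc F)]
    rfl

lemma exists_place {F : Type*} [Field F] (P : F[X]) (hsep : P.Separable) (hdeg : 0 < P.natDegree) :
    ∃ v : HeightOneSpectrum F[X], v.intValuation P = WithZero.exp (-1 : ℤ) := by
  have hP0 : P ≠ 0 := by rintro rfl; simp at hdeg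
  obtain ⟨π, hπ, hdvd⟩ := WfDvdMonoid.exists_irreducible_factor
    (fun h => hdeg.ne' (natDegree_eq_zero_of_isUnit h)) hP0
  let v : HeightOneSpectrum F[X] := ⟨Ideal.span {π},
    (Ideal.span_singleton_prime hπ.ne_zero).2 hπ.prime, by
      rw [Ne, Ideal.span_singleton_eq_bot]; exact hπ.ne_zero⟩
  refine ⟨v, ?_⟩
  obtain ⟨w, hw⟩ := hdvd
  have hv : v.asIdeal = Ideal.span {π} := rfl
  have hvw : v.intValuation w = 1 := by
    rw [HeightOneSpectrum.intValuation_eq_one_iff, hv, Ideal.mem_span_singleton]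
    rintro ⟨z, rfl⟩
    exact hπ.not_isUnit (hsep.squarefree π ⟨z, by rw [hw]; ring⟩)
  rw [hw, map_mul, hvw, mul_one, v.intValuation_singleton hπ.ne_zero hv]

lemma geom_zero {K : Type*} [Field K] {n : ℕ} {ω : K} (hω : IsPrimitiveRoot ω n) (k : ℕ)
    (hk : ¬ n ∣ k) : ∑ i ∈ Finset.range n, (ω ^ k) ^ i = 0 := by
  have h1 : ω ^ k ≠ 1 := fun h => hk (hω.dvd_of_pow_eq_one k h)
  have h2 := mul_geom_sum (ω ^ k) n
  rw [← pow_mul, mul_comm k n, pow_mul, hω.pow_eq_one, one_pow, sub_self] at h2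
  exact (mul_eq_zero.1 h2).resolve_left (sub_ne_zero.2 h1)

theorem regular_part {F : Type*} [Field F] [CharZero F] (E : Type*) [Field E] [Algebra (RatFunc F) E]
    [Algebra F E] [IsScalarTower F (RatFunc F) E] (n : ℕ) (hn : 2 ≤ n) (ζ : F)
    (hζ : IsPrimitiveRoot ζ n) (P : F[X]) (v : HeightOneSpectrum F[X])
    (hv : v.intValuation P = WithZero.exp (-1 : ℤ))
    (H : Irreducible (X ^ n - C (algebraMap F[X] (RatFunc F) P)))
    (hE : IsSplittingField (RatFunc F) E (X ^ n - C (algebraMap F[X] (RatFunc F) P)))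
    (x : E) (hx : IsAlgebraic F x) :
    ∃ a : F, algebraMap (RatFunc F) E (algebraMap F (RatFunc F) a) = x := by
  have hn0 : 0 < n := by omega
  have : NeZero n := ⟨by omega⟩
  have hζK : IsPrimitiveRoot (algebraMap F (RatFunc F) ζ) n :=
    hζ.map_of_injective (algebraMap F (RatFunc F)).injective
  have hζE : IsPrimitiveRoot (algebraMap F E ζ) n :=
    hζ.map_of_injective (algebraMap F E).injective
  have hne : (primitiveRoots n (RatFunc F)).Nonempty := ⟨_, (mem_primitiveRoots hn0).2 hζK⟩
  have hfd : FiniteDimensional (RatFunc F) E := IsSplittingField.finiteDimensional E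
    (X ^ n - C (algebraMap F[X] (RatFunc F) P))
  have hgal : IsGalois (RatFunc F) E := isGalois_of_isSplittingField_X_pow_sub_C hne H E
  obtain ⟨y, hy⟩ : ∃ y : E, y ^ n = algebraMap (RatFunc F) E (algebraMap F[X] (RatFunc F) P) := by
    obtain ⟨x, hx⟩ := hE.splits'.exists_eval_eq_zero (by
      rw [degree_map, degree_X_pow_sub_C hn0]; exact_mod_cast hn0.ne')
    refine ⟨x, ?_⟩
    simpa [sub_eq_zero] using hx
  have hP0 : P ≠ 0 := by
    rintro rfl
    rw [map_zero] at hv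
    exact WithZero.exp_ne_zero hv.symm
  have hy0 : y ≠ 0 := by
    rintro rfl
    rw [zero_pow hn0.ne', eq_comm, FaithfulSMul.algebraMap_eq_zero_iff,
      FaithfulSMul.algebraMap_eq_zero_iff] at hy
    exact hP0 hy
  let e := autEquivZmod H E hζK
  let σ := e.symm (Multiplicative.ofAdd (1 : ZMod n))
  have hσpow : ∀ k : ℕ, σ ^ k = e.symm (Multiplicative.ofAdd (k : ZMod n)) := by
    intro k
    rw [← map_pow, ← ofAdd_nsmul, nsmul_one]
  have hσy : σ y = algebraMap F E ζ * y := by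
    have := autEquivZmod_symm_apply_natCast H E hy hζK 1
    rw [Nat.cast_one, pow_one, Algebra.smul_def, ← IsScalarTower.algebraMap_apply] at this
    exact this
  have hσn : σ ^ n = 1 := by
    rw [hσpow, ZMod.natCast_self, ofAdd_zero, map_one]
  have hgen : ∀ τ : E ≃ₐ[RatFunc F] E, τ ∈ Subgroup.zpowers σ := by
    intro τ
    refine ⟨((Multiplicative.toAdd (e τ)).val : ℕ), ?_⟩
    change σ ^ (((Multiplicative.toAdd (e τ)).val : ℕ) : ℤ) = τ
    rw [zpow_natCast, hσpow, ZMod.natCast_zmod_val, ofAdd_toAdd, MulEquiv.symm_apply_apply]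
  have hfixed : ∀ z : E, σ z = z → ∃ f : RatFunc F, algebraMap (RatFunc F) E f = z := by
    intro z hz
    refine (IsGalois.mem_range_algebraMap_iff_fixed (F := RatFunc F) z).2 fun τ => ?_
    have h3 : σ ∈ MulAction.stabilizer (E ≃ₐ[RatFunc F] E) z := hz
    exact (Subgroup.zpowers_le.2 h3) (hgen τ)
  have hσF : ∀ a : F, σ (algebraMap F E a) = algebraMap F E a := by
    intro a
    rw [IsScalarTower.algebraMap_apply F (RatFunc F) E, AlgEquiv.commutes]
  set ω := algebraMap F E ζ⁻¹ with hω
  have hωζ : ω * algebraMap F E ζ = 1 := by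
    rw [hω, ← map_mul, inv_mul_cancel₀ (hζ.ne_zero hn0.ne'), map_one]
  have hωprim : IsPrimitiveRoot ω n := hζ.inv.map_of_injective (algebraMap F E).injective
  let r : ℕ → E := fun i => ∑ k ∈ Finset.range n, (ω ^ k) ^ i * (σ ^ k) x
  have hσr : ∀ i, σ (r i) = (algebraMap F E ζ) ^ i * r i := by
    intro i
    have h1 : ∀ k, (σ ^ (k + 1)) x = σ ((σ ^ k) x) := fun k => by
      rw [pow_succ', AlgEquiv.mul_apply]
    have hωF : σ ω = ω := hσF _
    have h2 : σ (r i) = ∑ k ∈ Finset.range n,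
        (algebraMap F E ζ) ^ i * ((ω ^ (k + 1)) ^ i * (σ ^ (k + 1)) x) := by
      simp only [r, map_sum, map_mul, map_pow, hωF]
      refine Finset.sum_congr rfl fun k _ => ?_
      rw [h1, ← mul_assoc, ← mul_pow, pow_succ, mul_comm, mul_comm (algebraMap F E ζ), mul_assoc (ω ^ k),
        hωζ, mul_one, mul_comm]
    rw [h2, ← Finset.mul_sum]
    congr 1
    have h3 := Finset.sum_range_succ (fun k => (ω ^ k) ^ i * (σ ^ k) x) n
    rw [Finset.sum_range_succ'] at h3
    simp only [hσn, hωprim.pow_eq_one, pow_zero] at h3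
    exact add_right_cancel h3
  have halg : ∀ i, IsAlgebraic F (r i) := by
    intro i
    rw [isAlgebraic_iff_isIntegral]
    refine IsIntegral.sum _ fun k _ => ?_
    refine IsIntegral.mul ?_ ?_
    · exact ((isIntegral_algebraMap (R := F) (x := ζ⁻¹)).pow _).pow _
    · exact (isAlgebraic_iff_isIntegral.1 hx).map (((σ ^ k : E ≃ₐ[RatFunc F] E)).restrictScalars F)
  have hzero : ∀ i, 0 < i → i < n → r i = 0 := by
    intro i hi hin
    obtain ⟨f, hf⟩ := hfixed (r i / y ^ i) (by
      rw [map_div₀, map_pow, hσr, hσy, mul_pow]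
      have : algebraMap F E ζ ≠ 0 := right_ne_zero_of_mul_eq_one hωζ
      field_simp)
    have hrf : r i = algebraMap (RatFunc F) E f * y ^ i := by
      rw [hf, div_mul_cancel₀ _ (pow_ne_zero _ hy0)]
    have hrn : algebraMap (RatFunc F) E (f ^ n * (algebraMap F[X] (RatFunc F) P) ^ i) = r i ^ n := by
      rw [map_mul, map_pow, map_pow, ← hy, hrf]; ring
    have h1 : IsAlgebraic F (f ^ n * (algebraMap F[X] (RatFunc F) P) ^ i) := by
      rw [← isAlgebraic_algebraMap_iff (A := E) (algebraMap (RatFunc F) E).injective, hrn]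
      exact (halg i).pow n
    obtain ⟨a, ha⟩ := ratFunc_const _ h1
    by_contra hr0
    have hf0 : f ≠ 0 := by
      rintro rfl
      rw [map_zero, zero_mul] at hrf
      exact hr0 hrf
    have hPK : algebraMap F[X] (RatFunc F) P ≠ 0 := by
      rw [Ne, FaithfulSMul.algebraMap_eq_zero_iff]; exact hP0
    have ha0 : a ≠ 0 := by
      rintro rfl
      rw [map_zero] at ha
      exact mul_ne_zero (pow_ne_zero _ hf0) (pow_ne_zero _ hPK) ha.symm
    have hva : v.valuation (RatFunc F) (algebraMap F (RatFunc F) a) = 1 := by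
      rw [IsScalarTower.algebraMap_apply F F[X] (RatFunc F),
        HeightOneSpectrum.valuation_eq_one_iff_notMem]
      intro hmem
      exact v.isPrime.ne_top (Ideal.eq_top_of_isUnit_mem _ hmem
        ((isUnit_iff_ne_zero.2 ha0).map (algebraMap F F[X])))
    rw [ha, map_mul, map_pow, map_pow, HeightOneSpectrum.valuation_of_algebraMap, hv] at hva
    obtain ⟨k, hk⟩ : ∃ k : ℤ, v.valuation (RatFunc F) f = WithZero.exp k :=
      ⟨_, (WithZero.exp_log ((Valuation.ne_zero_iff _).2 hf0)).symm⟩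
    rw [hk, ← WithZero.exp_nsmul, ← WithZero.exp_nsmul, ← WithZero.exp_add, WithZero.exp_eq_one] at hva
    simp only [nsmul_eq_mul] at hva
    have h4 : (n : ℤ) ∣ i := ⟨k, by linarith⟩
    exact absurd (Nat.le_of_dvd hi (Int.natCast_dvd_natCast.1 h4)) (by omega)
  have hsum : ∑ i ∈ Finset.range n, r i = (n : E) * x := by
    simp only [r]
    rw [Finset.sum_comm]
    simp_rw [← Finset.sum_mul]
    rw [Finset.sum_eq_single 0]
    · simp
    · intro k hk hk0
      rw [geom_zero hωprim k, zero_mul]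
      intro hd
      exact absurd (Nat.le_of_dvd (Nat.pos_of_ne_zero hk0) hd) (by simpa using hk)
    · intro h
      exact absurd (Finset.mem_range.2 hn0) h
  rw [Finset.sum_eq_single 0 (fun i hi hi0 => hzero i (Nat.pos_of_ne_zero hi0) (Finset.mem_range.1 hi))
    (fun h => absurd (Finset.mem_range.2 hn0) h)] at hsum
  have hnE : (n : E) ≠ 0 := by
    have : (n : F) ≠ 0 := by exact_mod_cast hn0.ne'
    have h5 := (FaithfulSMul.algebraMap_eq_zero_iff F E (r := (n : F))).not.2 this
    rwa [map_natCast] at h5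
  have hσx : σ x = x := by
    have h6 := hσr 0
    rw [pow_zero, one_mul, hsum, map_mul, map_natCast] at h6
    exact mul_left_cancel₀ hnE h6
  obtain ⟨f, hf⟩ := hfixed x hσx
  have h7 : IsAlgebraic F f := by
    rw [← isAlgebraic_algebraMap_iff (A := E) (algebraMap (RatFunc F) E).injective, hf]
    exact hx
  obtain ⟨a, ha⟩ := ratFunc_const f h7
  exact ⟨a, by rw [ha, hf]⟩
end E1



open Polynomial NumberField IntermediateField

lemma regular_part_comp {F : Type*} [Field F] [CharZero F] (E : Type*) [Field E]
    [Algebra (RatFunc F) E] (n : ℕ) (hn : 2 ≤ n) (ζ : F) (hζ : IsPrimitiveRoot ζ n)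
    (P : F[X]) (v : IsDedekindDomain.HeightOneSpectrum F[X])
    (hv : v.intValuation P = WithZero.exp (-1 : ℤ))
    (H : Irreducible (X ^ n - C (algebraMap F[X] (RatFunc F) P)))
    (hE : IsSplittingField (RatFunc F) E (X ^ n - C (algebraMap F[X] (RatFunc F) P)))
    (x : E)
    (hx : @IsAlgebraic F E _ _
      ((algebraMap (RatFunc F) E).comp (algebraMap F (RatFunc F))).toAlgebra x) :
    ∃ a : F, algebraMap (RatFunc F) E (algebraMap F (RatFunc F) a) = x := by
  let instA : Algebra F E :=
    ((algebraMap (RatFunc F) E).comp (algebraMap F (RatFunc F))).toAlgebra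
  have hT : IsScalarTower F (RatFunc F) E := IsScalarTower.of_algebraMap_eq (fun _ => rfl)
  exact regular_part E n hn ζ hζ P v hv H hE x hx

/-- Non-parametricity: if `F ⊇ μ_n`, `n ∣ N = deg P`, `P ∈ O_F[T]` is separable and its
Galois group has an element fixing no root, then `E = F(T)(P(T)^{1/n})` is an `F`-regular
Galois extension of `F(T)` with group `ℤ/nℤ`, and for every `n'' ≥ 2 ` dividing `n` (i.e. for
every nontrivial subgroup of `ℤ/nℤ`) there is a cyclic extension of `F` of degree `n''` which
is not a specialization of `E/F(T)` (the specializations being the fields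
`F(P(t₀)^{1/n})` for `t₀` not a root of `P`, together with `F(a_N^{1/n})` at `∞`). -/
theorem stmt19 (F : Type*) [Field F] [NumberField F] (n N : ℕ) (hn : 2 ≤ n) (hN : 0 < N)
    (hnN : n ∣ N) (hζ : ∃ ζ : F, IsPrimitiveRoot ζ n)
    (p : Polynomial (𝓞 F)) (hdeg : p.natDegree = N)
    (hsep : (p.map (algebraMap (𝓞 F) F)).Separable)
    (hGal : ∃ σ : (p.map (algebraMap (𝓞 F) F)).SplittingField ≃ₐ[F]
        (p.map (algebraMap (𝓞 F) F)).SplittingField,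
      ∀ t : (p.map (algebraMap (𝓞 F) F)).SplittingField,
        aeval t (p.map (algebraMap (𝓞 F) F)) = 0 → σ t ≠ t) :
    letI E := ((X : Polynomial (RatFunc F)) ^ n -
      C (algebraMap F[X] (RatFunc F) (p.map (algebraMap (𝓞 F) F)))).SplittingField
    letI : Algebra F E :=
      ((algebraMap (RatFunc F) E).comp (algebraMap F (RatFunc F))).toAlgebra
    (∀ x : E, IsAlgebraic F x →
        ∃ a : F, algebraMap (RatFunc F) E (algebraMap F (RatFunc F) a) = x) ∧
    IsGalois (RatFunc F) E ∧ IsCyclic (E ≃ₐ[RatFunc F] E) ∧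
    Nat.card (E ≃ₐ[RatFunc F] E) = n ∧
    (∀ n'' : ℕ, 2 ≤ n'' → n'' ∣ n →
      ∃ M : IntermediateField F (AlgebraicClosure F),
        IsGalois F M ∧ IsCyclic (M ≃ₐ[F] M) ∧ Nat.card (M ≃ₐ[F] M) = n'' ∧
        ¬ ((∃ t₀ : F, (p.map (algebraMap (𝓞 F) F)).eval t₀ ≠ 0 ∧
              M = IntermediateField.adjoin F
                (((X : F[X]) ^ n - C ((p.map (algebraMap (𝓞 F) F)).eval t₀)).rootSet
                  (AlgebraicClosure F))) ∨
            M = IntermediateField.adjoin F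
              (((X : F[X]) ^ n - C ((p.map (algebraMap (𝓞 F) F)).leadingCoeff)).rootSet
                (AlgebraicClosure F)))) := by

  obtain ⟨ζ, hζ⟩ := hζ
  have hp0 : p ≠ 0 := by
    rintro rfl
    simp at hdeg
    omega
  have hdegP : (p.map (algebraMap (𝓞 F) F)).natDegree = N := by
    rw [natDegree_map_eq_of_injective (FaithfulSMul.algebraMap_injective (𝓞 F) F), hdeg]
  have hns := nonspec F n hn ζ hζ p hp0 (hdeg ▸ hnN) hsep hGal
  clear hGal
  obtain ⟨v, hv⟩ := exists_place (p.map (algebraMap (𝓞 F) F)) hsep (by omega)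
  have H : Irreducible ((X : Polynomial (RatFunc F)) ^ n -
      C (algebraMap F[X] (RatFunc F) (p.map (algebraMap (𝓞 F) F)))) := by
    apply irreducible_X_pow_sub_C_of_prime v.asIdeal v.isPrime _ _ _ n (by omega)
    · rw [← pow_one v.asIdeal]
      exact (v.intValuation_le_pow_iff_mem _ 1).1 (by rw [hv]; simp)
    · intro h
      have := (v.intValuation_le_pow_iff_mem _ 2).2 h
      rw [hv, WithZero.exp_le_exp] at this
      norm_num at this
  have hne : (primitiveRoots n (RatFunc F)).Nonempty :=
    ⟨_, (mem_primitiveRoots (by omega)).2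
      (hζ.map_of_injective (algebraMap F (RatFunc F)).injective)⟩
  have : NeZero n := ⟨by omega⟩
  have hS := IsSplittingField.splittingField ((X : Polynomial (RatFunc F)) ^ n -
      C (algebraMap F[X] (RatFunc F) (p.map (algebraMap (𝓞 F) F))))
  let E := ((X : Polynomial (RatFunc F)) ^ n -
      C (algebraMap F[X] (RatFunc F) (p.map (algebraMap (𝓞 F) F)))).SplittingField
  have hG : IsGalois (RatFunc F) E := isGalois_of_isSplittingField_X_pow_sub_C hne H E
  have hC : IsCyclic (E ≃ₐ[RatFunc F] E) := isCyclic_of_isSplittingField_X_pow_sub_C hne H E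
  have hfd : FiniteDimensional (RatFunc F) E := IsSplittingField.finiteDimensional E
    ((X : Polynomial (RatFunc F)) ^ n -
      C (algebraMap F[X] (RatFunc F) (p.map (algebraMap (𝓞 F) F))))
  refine ⟨?_, hG, hC, ?_, hns⟩
  · intro x hx
    exact regular_part_comp E n hn ζ hζ _ v hv H hS x hx
  · rw [IsGalois.card_aut_eq_finrank]
    exact finrank_of_isSplittingField_X_pow_sub_C hne H E
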